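/- Let G be an n-vertex Δ-critical simple graph with minimum degree at least 3 and maximum degree Δ ≥ 5^25. Then α(G) < 7n/12. -/

import Mathlib

open Finset

variable {V : Type*}

/-- `φ` is a proper edge coloring of `G` with colors in `{1, …, k}`, encoded as a symmetric
function on ordered pairs of vertices: every edge receives a color in `[1,k]` and two distinct
edges sharing a vertex receive different colors. -/
def IsEdgeColoring (G : SimpleGraph V) (k : ℕ) (φ : V → V → ℕ) : Prop :=
  (∀ u v, φ u v = φ v u) ∧
  (∀ ⦃u v⦄, G.Adj u v → φ u v ∈ Finset.Icc 1 k) ∧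
  (∀ ⦃v a b⦄, G.Adj v a → G.Adj v b → a ≠ b → φ v a ≠ φ v b)

/-- The chromatic index of `G`: the least `k` such that `G` has a proper edge `k`-coloring. -/
noncomputable def chromIndex (G : SimpleGraph V) : ℕ :=
  sInf {k | ∃ φ : V → V → ℕ, IsEdgeColoring G k φ}

/-- `G` is `Δ`-critical: `G` is connected, `χ'(G) = Δ + 1`, and `χ'(G - e) = Δ` for every
edge `e` of `G`, where `Δ` is the maximum degree of `G`. -/
def IsDeltaCritical [Fintype V] (G : SimpleGraph V) [DecidableRel G.Adj] : Prop :=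
  G.Connected ∧ chromIndex G = G.maxDegree + 1 ∧
    ∀ e ∈ G.edgeSet, chromIndex (G.deleteEdges {e}) = G.maxDegree

/-- The independence number of `G`. -/
noncomputable def indepNum [Fintype V] (G : SimpleGraph V) : ℕ :=
  sSup {n | ∃ s : Finset V, (∀ u ∈ s, ∀ v ∈ s, u ≠ v → ¬ G.Adj u v) ∧ s.card = n}

namespace Crit

/-- Partial proper edge colouring of `G` with colours `1..D`; `0` means not coloured; the only
edge without a colour is `xy`. -/
structure Col (G : SimpleGraph V) (D : ℕ) (x y : V) (φ : V → V → ℕ) : Prop where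
  symm : ∀ u v, φ u v = φ v u
  le : ∀ u v, φ u v ≤ D
  adj : ∀ u v, φ u v ≠ 0 → G.Adj u v
  inj : ∀ u v w, φ u v ≠ 0 → φ u v = φ u w → v = w
  unc : φ x y = 0
  col : ∀ u v, G.Adj u v → φ u v = 0 → (u = x ∧ v = y) ∨ (u = y ∧ v = x)
  xy : G.Adj x y

/-- colour `c` is missing at `v` -/
def Miss (φ : V → V → ℕ) (v : V) (c : ℕ) : Prop := ∀ w, φ v w ≠ c

/-- there is no proper colouring with colours `1..D` -/
def NoCol (G : SimpleGraph V) (D : ℕ) : Prop :=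
  ∀ φ : V → V → ℕ, (∀ u v, φ u v = φ v u) → (∀ u v, φ u v ≤ D) →
    (∀ u v, G.Adj u v → φ u v ≠ 0) → (∀ u v w, φ u v ≠ 0 → φ u v = φ u w → v = w) → False

open Classical in
/-- Kempe change on the vertex set `S`. -/
noncomputable def sw (φ : V → V → ℕ) (S : Set V) (a b : ℕ) : V → V → ℕ :=
  fun u v => if u ∈ S then Equiv.swap a b (φ u v) else φ u v

/-- `S` is a union of components of the `a,b`-coloured subgraph. -/
def Cl (φ : V → V → ℕ) (S : Set V) (a b : ℕ) : Prop :=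
  ∀ u v, (φ u v = a ∨ φ u v = b) → (u ∈ S ↔ v ∈ S)

open Classical in
/-- change the colour of the edge `uv` to `c` -/
noncomputable def upd (φ : V → V → ℕ) (u v : V) (c : ℕ) : V → V → ℕ :=
  fun p q => if (p = u ∧ q = v) ∨ (p = v ∧ q = u) then c else φ p q

/-- The component of `v`. -/
def comp (φ : V → V → ℕ) (a b : ℕ) (v : V) : Set V :=
  {u | Relation.ReflTransGen (fun p q => φ p q = a ∨ φ p q = b) v u}

variable {G : SimpleGraph V} {D : ℕ} {x y : V} {φ : V → V → ℕ}

lemma Col.self (h : Col G D x y φ) (u : V) : φ u u = 0 := by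
  by_contra h0
  exact G.loopless.irrefl _ (h.adj _ _ h0)

lemma Col.ne (h : Col G D x y φ) : x ≠ y := h.xy.ne

lemma Col.unc' (h : Col G D x y φ) : φ y x = 0 := by rw [h.symm]; exact h.unc

lemma sw_out {S : Set V} {a b : ℕ} {u : V} (hu : u ∉ S) (v : V) : sw φ S a b u v = φ u v := by
  simp [sw, hu]

lemma sw_in {S : Set V} {a b : ℕ} {u : V} (hu : u ∈ S) (v : V) :
    sw φ S a b u v = Equiv.swap a b (φ u v) := by
  simp [sw, hu]

lemma sw_other {S : Set V} {a b : ℕ} {u v : V} (h1 : φ u v ≠ a) (h2 : φ u v ≠ b) :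
    sw φ S a b u v = φ u v := by
  by_cases hu : u ∈ S
  · rw [sw_in hu, Equiv.swap_apply_of_ne_of_ne h1 h2]
  · exact sw_out hu v

lemma miss_sw_out {S : Set V} {a b c : ℕ} {u : V} (hu : u ∉ S) :
    Miss (sw φ S a b) u c ↔ Miss φ u c := by
  simp [Miss, sw_out hu]

lemma miss_sw_in {S : Set V} {a b c : ℕ} {u : V} (hu : u ∈ S) :
    Miss (sw φ S a b) u c ↔ Miss φ u (Equiv.swap a b c) := by
  simp only [Miss, sw_in hu]
  constructor
  · intro h w hw
    apply h w
    rw [hw, Equiv.swap_apply_self]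
  · intro h w hw
    apply h w
    rw [← hw, Equiv.swap_apply_self]

lemma miss_sw_in_left {S : Set V} {a b : ℕ} {u : V} (hu : u ∈ S) :
    Miss (sw φ S a b) u a ↔ Miss φ u b := by
  rw [miss_sw_in hu, Equiv.swap_apply_left]

lemma miss_sw_in_right {S : Set V} {a b : ℕ} {u : V} (hu : u ∈ S) :
    Miss (sw φ S a b) u b ↔ Miss φ u a := by
  rw [miss_sw_in hu, Equiv.swap_apply_right]

lemma miss_sw_other {S : Set V} {a b c : ℕ} {u : V} (h1 : c ≠ a) (h2 : c ≠ b) :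
    Miss (sw φ S a b) u c ↔ Miss φ u c := by
  by_cases hu : u ∈ S
  · rw [miss_sw_in hu, Equiv.swap_apply_of_ne_of_ne h1 h2]
  · exact miss_sw_out hu

lemma Col.sw (h : Col G D x y φ) {S : Set V} {a b : ℕ} (hS : Cl φ S a b)
    (ha : a ≠ 0) (hb : b ≠ 0) (haD : a ≤ D) (hbD : b ≤ D) : Col G D x y (sw φ S a b) := by
  have h0 : Equiv.swap a b 0 = 0 := Equiv.swap_apply_of_ne_of_ne ha.symm hb.symm
  have hz : ∀ u v, Crit.sw φ S a b u v = 0 ↔ φ u v = 0 := by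
    intro u v
    by_cases hu : u ∈ S
    · rw [sw_in hu]
      constructor
      · intro h1
        rw [← h0] at h1
        exact (Equiv.swap a b).injective h1
      · intro h1; rw [h1, h0]
    · rw [sw_out hu]
  refine ⟨?_, ?_, ?_, ?_, ?_, ?_, h.xy⟩
  · intro u v
    by_cases hc : φ u v = a ∨ φ u v = b
    · have h1 := hS u v hc
      by_cases hu : u ∈ S
      · rw [sw_in hu, sw_in (h1.1 hu), h.symm]
      · rw [sw_out hu, sw_out (fun h2 => hu (h1.2 h2)), h.symm]
    · push Not at hc
      rw [sw_other hc.1 hc.2, sw_other (by rw [h.symm]; exact hc.1) (by rw [h.symm]; exact hc.2),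
        h.symm]
  · intro u v
    by_cases hc : φ u v = a ∨ φ u v = b
    · by_cases hu : u ∈ S
      · rw [sw_in hu]
        rcases hc with hc | hc <;> rw [hc] <;> simp [haD, hbD]
      · rw [sw_out hu]; exact h.le _ _
    · push Not at hc
      rw [sw_other hc.1 hc.2]; exact h.le _ _
  · intro u v h1
    exact h.adj u v (fun h2 => h1 ((hz u v).2 h2))
  · intro u v w h1 h2
    have h3 : φ u v ≠ 0 := fun h2 => h1 ((hz u v).2 h2)
    by_cases hu : u ∈ S
    · rw [sw_in hu, sw_in hu] at h2
      exact h.inj u v w h3 ((Equiv.swap a b).injective h2)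
    · rw [sw_out hu, sw_out hu] at h2
      exact h.inj u v w h3 h2
  · exact (hz _ _).2 h.unc
  · intro u v h1 h2
    exact h.col u v h1 ((hz _ _).1 h2)

lemma mem_comp_self (a b : ℕ) (v : V) : v ∈ comp φ a b v := Relation.ReflTransGen.refl

lemma Col.comp_cl (h : Col G D x y φ) (a b : ℕ) (v : V) : Cl φ (comp φ a b v) a b := by
  intro p q hpq
  constructor
  · intro hp
    exact Relation.ReflTransGen.tail hp hpq
  · intro hq
    refine Relation.ReflTransGen.tail hq ?_
    rw [h.symm]; exact hpq

lemma Col.comp_symm (h : Col G D x y φ) {a b : ℕ} {u v : V} (hu : u ∈ comp φ a b v) :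
    v ∈ comp φ a b u := by
  have : ∀ w, Relation.ReflTransGen (fun p q => φ p q = a ∨ φ p q = b) v w → v ∈ comp φ a b w := by
    intro w hw
    induction hw with
    | refl => exact mem_comp_self a b v
    | tail h1 h2 ih =>
      refine Relation.ReflTransGen.head ?_ ih
      rw [h.symm]; exact h2
  exact this u hu

lemma comp_trans {a b : ℕ} {u v w : V} (hu : u ∈ comp φ a b v) (hw : w ∈ comp φ a b u) :
    w ∈ comp φ a b v := Relation.ReflTransGen.trans hu hw

lemma cl_compl {S : Set V} {a b : ℕ} (h : Cl φ S a b) : Cl φ Sᶜ a b := by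
  intro u v huv
  simp [h u v huv]

lemma cl_union {S T : Set V} {a b : ℕ} (h : Cl φ S a b) (h' : Cl φ T a b) : Cl φ (S ∪ T) a b := by
  intro u v huv
  simp [h u v huv, h' u v huv]

/-- three ends -/
lemma Col.three [Fintype V] (h : Col G D x y φ) {a b : ℕ} (ha : a ≠ 0) (hb : b ≠ 0) {v u₁ u₂ u₃ : V}
    (h1 : u₁ ∈ comp φ a b v) (h2 : u₂ ∈ comp φ a b v) (h3 : u₃ ∈ comp φ a b v)
    (h12 : u₁ ≠ u₂) (h13 : u₁ ≠ u₃) (h23 : u₂ ≠ u₃)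
    (m1 : Miss φ u₁ a ∨ Miss φ u₁ b) (m2 : Miss φ u₂ a ∨ Miss φ u₂ b)
    (m3 : Miss φ u₃ a ∨ Miss φ u₃ b) : False := by
  classical
  let C := comp φ a b v
  let H : SimpleGraph C :=
    { Adj := fun p q => φ p q = a ∨ φ p q = b
      symm := ⟨fun p q hpq => by rw [h.symm]; exact hpq⟩
      loopless := ⟨fun p hp => by
        rw [h.self] at hp
        rcases hp with hp | hp
        · exact ha hp.symm
        · exact hb hp.symm⟩ }
  have hreach : ∀ w, Relation.ReflTransGen (fun p q => φ p q = a ∨ φ p q = b) v w →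
      ∀ hw : w ∈ C, H.Reachable ⟨v, mem_comp_self a b v⟩ ⟨w, hw⟩ := by
    intro w hw
    induction hw with
    | refl => intro _; exact SimpleGraph.Reachable.refl _
    | @tail p q hp hpq ih =>
      intro hq
      refine (ih hp).trans (SimpleGraph.Adj.reachable ?_)
      exact hpq
  have hconn : H.Connected := by
    haveI : Nonempty C := ⟨⟨v, mem_comp_self a b v⟩⟩
    refine SimpleGraph.Connected.mk ?_
    intro p q
    exact (hreach p.1 p.2 p.2).symm.trans (hreach q.1 q.2 q.2)
  have hcard := hconn.card_vert_le_card_edgeSet_add_one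
  have hsum := H.sum_degrees_eq_twice_card_edges
  have hsub : ∀ (p : C) (c : ℕ), c ≠ 0 →
      (Finset.univ.filter (fun q : C => φ p q = c)).card ≤ 1 := by
    intro p c hc
    rw [Finset.card_le_one]
    intro q hq r hr
    simp only [Finset.mem_filter, Finset.mem_univ, true_and] at hq hr
    apply Subtype.ext
    exact h.inj p q r (by rw [hq]; exact hc) (by rw [hq, hr])
  have hnb : ∀ p : C, H.neighborFinset p =
      Finset.univ.filter (fun q : C => φ p q = a) ∪ Finset.univ.filter (fun q : C => φ p q = b) := by
    intro p
    ext q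
    simp [H]
  have hdeg : ∀ p : C, H.degree p ≤ 2 := by
    intro p
    rw [← SimpleGraph.card_neighborFinset_eq_degree, hnb]
    refine (Finset.card_union_le _ _).trans ?_
    have := hsub p a ha
    have := hsub p b hb
    omega
  have hdeg1 : ∀ p : C, (Miss φ p a ∨ Miss φ p b) → H.degree p ≤ 1 := by
    intro p hp
    rw [← SimpleGraph.card_neighborFinset_eq_degree, hnb]
    refine (Finset.card_union_le _ _).trans ?_
    have e1 := hsub p a ha
    have e2 := hsub p b hb
    rcases hp with hp | hp
    · have : (Finset.univ.filter (fun q : C => φ p q = a)) = ∅ := by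
        ext q; simp [hp q]
      rw [this]; simpa using e2
    · have : (Finset.univ.filter (fun q : C => φ p q = b)) = ∅ := by
        ext q; simp [hp q]
      rw [this]; simpa using e1
  let T : Finset C := {⟨u₁, h1⟩, ⟨u₂, h2⟩, ⟨u₃, h3⟩}
  have hT : T.card = 3 := by
    rw [Finset.card_eq_three]
    exact ⟨_, _, _, by simpa using h12, by simpa using h13, by simpa using h23, rfl⟩
  have hle : ∀ p : C, H.degree p + (if p ∈ T then 1 else 0) ≤ 2 := by
    intro p
    by_cases hp : p ∈ T
    · have : H.degree p ≤ 1 := by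
        apply hdeg1
        simp only [T, Finset.mem_insert, Finset.mem_singleton] at hp
        rcases hp with rfl | rfl | rfl
        · exact m1
        · exact m2
        · exact m3
      simp [hp]; omega
    · simp [hp]; exact hdeg p
  have hs2 : ∑ p : C, (H.degree p + (if p ∈ T then 1 else 0)) ≤ ∑ p : C, 2 :=
    Finset.sum_le_sum (fun p _ => hle p)
  rw [Finset.sum_add_distrib, hsum] at hs2
  have e3 : ∑ p : C, (if p ∈ T then 1 else 0) = 3 := by
    rw [← hT]; simp
  rw [e3] at hs2
  have e4 : ∑ p : C, 2 = 2 * Fintype.card C := by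
    simp [mul_comm]
  rw [e4] at hs2
  rw [Nat.card_eq_fintype_card, Nat.card_eq_fintype_card, ← SimpleGraph.edgeFinset_card] at hcard
  omega

lemma upd_same (φ : V → V → ℕ) (u v : V) (c : ℕ) : upd φ u v c u v = c := by simp [upd]

lemma upd_same' (φ : V → V → ℕ) (u v : V) (c : ℕ) : upd φ u v c v u = c := by simp [upd]

lemma upd_ne (φ : V → V → ℕ) {u v p q : V} (c : ℕ) (h1 : ¬ (p = u ∧ q = v))
    (h2 : ¬ (p = v ∧ q = u)) : upd φ u v c p q = φ p q := by
  unfold upd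
  rw [if_neg]
  tauto

lemma upd_out (φ : V → V → ℕ) {u v p : V} (c : ℕ) (h1 : p ≠ u) (h2 : p ≠ v) (q : V) :
    upd φ u v c p q = φ p q := upd_ne φ c (by tauto) (by tauto)

lemma miss_upd_out (φ : V → V → ℕ) {u v p : V} (c : ℕ) (h1 : p ≠ u) (h2 : p ≠ v) (d : ℕ) :
    Miss (upd φ u v c) p d ↔ Miss φ p d := by
  simp [Miss, upd_out φ c h1 h2]

lemma upd_symm (h : ∀ p q, φ p q = φ q p) (u v : V) (c : ℕ) (p q : V) :
    upd φ u v c p q = upd φ u v c q p := by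
  unfold upd
  rw [h p q]
  congr 1
  apply propext
  tauto

/-- properness of an update -/
lemma upd_inj (hs : ∀ p q, φ p q = φ q p)
    (hi : ∀ u v w, φ u v ≠ 0 → φ u v = φ u w → v = w) {u v : V} {c : ℕ}
    (hu : Miss φ u c) (hv : Miss φ v c) :
    ∀ p q r, upd φ u v c p q ≠ 0 → upd φ u v c p q = upd φ u v c p r → q = r := by
  intro p q r h0 h1
  unfold upd at h0 h1
  split_ifs at h0 h1 with e1 e2 e2
  · rcases e1 with ⟨rfl, rfl⟩ | ⟨rfl, rfl⟩ <;> rcases e2 with ⟨e, rfl⟩ | ⟨e, rfl⟩ <;> simp_all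
  · rcases e1 with ⟨rfl, rfl⟩ | ⟨rfl, rfl⟩
    · exact absurd h1.symm (hu r)
    · exact absurd h1.symm (hv r)
  · rcases e2 with ⟨rfl, rfl⟩ | ⟨rfl, rfl⟩
    · exact absurd h1 (hu q)
    · exact absurd h1 (hv q)
  · exact hi p q r h0 h1

/-- F0 -/
lemma Col.nocommon (h : Col G D x y φ) (hno : NoCol G D) {c : ℕ} (hc : c ≠ 0) (hcD : c ≤ D)
    (hx : Miss φ x c) (hy : Miss φ y c) : False := by
  refine hno (upd φ x y c) (upd_symm h.symm x y c) ?_ ?_ (upd_inj h.symm h.inj hx hy)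
  · intro u v
    unfold upd
    split_ifs
    · exact hcD
    · exact h.le _ _
  · intro u v huv
    unfold upd
    split_ifs with e
    · exact hc
    · intro h0
      exact e (h.col u v huv h0)

/-- recolour the edge `yt` -/
lemma Col.recolor (h : Col G D x y φ) {t : V} {c : ℕ} (ht : φ y t ≠ 0) (hc : c ≠ 0) (hcD : c ≤ D)
    (hy : Miss φ y c) (hmt : Miss φ t c) : Col G D x y (upd φ y t c) := by
  have htx : t ≠ x := by
    rintro rfl
    exact ht h.unc'
  refine ⟨upd_symm h.symm y t c, ?_, ?_, upd_inj h.symm h.inj hy hmt, ?_, ?_, h.xy⟩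
  · intro u v
    unfold upd
    split_ifs
    · exact hcD
    · exact h.le _ _
  · intro u v
    unfold upd
    split_ifs with e
    · intro _
      rcases e with ⟨rfl, rfl⟩ | ⟨rfl, rfl⟩
      · exact h.adj _ _ ht
      · exact (h.adj _ _ ht).symm
    · exact h.adj _ _
  · rw [upd_ne]
    · exact h.unc
    · rintro ⟨e, _⟩; exact h.ne e
    · rintro ⟨e, _⟩; exact htx e.symm
  · intro u v huv
    unfold upd
    split_ifs with e
    · intro e'; exact absurd e' hc
    · exact h.col u v huv

/-- after recolouring, `y` misses the old colour -/
lemma Col.recolor_miss_y (h : Col G D x y φ) {t : V} {c : ℕ} (ht : φ y t ≠ 0)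
    (hy : Miss φ y c) : Miss (upd φ y t c) y (φ y t) := by
  intro w hw
  by_cases e : w = t
  · subst e
    rw [upd_same] at hw
    exact hy w hw.symm
  · have hyt : y ≠ t := (h.adj _ _ ht).ne
    rw [upd_ne φ c (by tauto) (by tauto)] at hw
    exact e (h.inj y w t (by rw [hw]; exact ht) hw)

lemma Col.recolor_miss_t (h : Col G D x y φ) {t : V} {c : ℕ} (ht : φ y t ≠ 0)
    (hmt : Miss φ t c) : Miss (upd φ y t c) t (φ y t) := by
  intro w hw
  by_cases e : w = y
  · subst e
    rw [upd_same'] at hw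
    exact hmt w (by rw [hw, h.symm])
  · have hyt : y ≠ t := (h.adj _ _ ht).ne
    rw [upd_ne φ c (by tauto) (by tauto), h.symm y t] at hw
    exact e (h.inj t w y (by rw [hw, h.symm]; exact ht) hw)

/-- other missing colours are kept at all vertices -/
lemma miss_upd {u v p : V} {c d : ℕ} (hcd : d ≠ c) (hm : Miss φ p d) :
    Miss (upd φ u v c) p d := by
  intro w hw
  unfold upd at hw
  split_ifs at hw with e
  · exact hcd hw.symm
  · exact hm w hw

/-- shift the edge without colour from `xy` to `xz` -/
lemma Col.shift (h : Col G D x y φ) {z : V} {α : ℕ} (hα : α ≠ 0) (hz : φ x z = α)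
    (hy : Miss φ y α) : Col G D x z (upd (upd φ x z 0) x y α) := by
  have hadj : G.Adj x z := h.adj _ _ (by rw [hz]; exact hα)
  have hzy : z ≠ y := by
    rintro rfl
    rw [h.unc] at hz; exact hα hz.symm
  have hyx : y ≠ x := h.ne.symm
  have hxz : x ≠ z := hadj.ne
  have hs : ∀ p q, upd φ x z 0 p q = upd φ x z 0 q p := upd_symm h.symm x z 0
  have hαD : α ≤ D := by rw [← hz]; exact h.le _ _
  refine ⟨upd_symm hs x y α, ?_, ?_, upd_inj hs ?_ ?_ ?_, ?_, ?_, hadj⟩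
  · intro u v
    unfold upd
    split_ifs
    · exact hαD
    · exact Nat.zero_le _
    · exact h.le _ _
  · intro u v
    unfold upd
    split_ifs with e e'
    · intro _
      rcases e with ⟨rfl, rfl⟩ | ⟨rfl, rfl⟩
      · exact h.xy
      · exact h.xy.symm
    · intro h0; exact absurd rfl h0
    · exact h.adj _ _
  · intro p q r h0 h1
    unfold upd at h0 h1
    split_ifs at h0 h1 with e1 e2 e3
    · exact absurd rfl h0
    · exact absurd rfl h0
    · exact absurd h1 h0
    · exact h.inj p q r h0 h1
  · intro w hw
    unfold upd at hw
    split_ifs at hw with e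
    · exact hα hw.symm
    · have : w = z := h.inj x w z (by rw [hw]; exact hα) (by rw [hw, hz])
      exact e (Or.inl ⟨rfl, this⟩)
  · intro w hw
    rw [upd_out φ 0 hyx hzy.symm] at hw
    exact hy w hw
  · rw [upd_ne _ _ (by tauto) (by tauto), upd_same]
  · intro u v huv
    unfold upd
    split_ifs with e e'
    · intro e0; exact absurd e0 hα
    · intro _; exact e'
    · intro h0
      exact absurd (h.col u v huv h0) e



/-- colour `c` is one of `1..D` and missing at `x` -/
def InL (D : ℕ) (φ : V → V → ℕ) (x : V) (c : ℕ) : Prop := c ≠ 0 ∧ c ≤ D ∧ Miss φ x c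

lemma InL.sw_other {S : Set V} {a b c : ℕ} {u : V} (h1 : c ≠ a) (h2 : c ≠ b) (h : InL D φ u c) :
    InL D (sw φ S a b) u c := ⟨h.1, h.2.1, (miss_sw_other h1 h2).2 h.2.2⟩

lemma InL.sw_out {S : Set V} {a b c : ℕ} {u : V} (hu : u ∉ S) (h : InL D φ u c) :
    InL D (sw φ S a b) u c := ⟨h.1, h.2.1, (miss_sw_out hu).2 h.2.2⟩

lemma InL.upd {u v p : V} {c d : ℕ} (hcd : d ≠ c) (hm : InL D φ p d) :
    InL D (upd φ u v c) p d := ⟨hm.1, hm.2.1, miss_upd hcd hm.2.2⟩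

lemma Col.ne_beta (h : Col G D x y φ) (hno : NoCol G D) {b c : ℕ} (hb : InL D φ y b)
    (hc : InL D φ x c) : c ≠ b := by
  rintro rfl
  exact h.nocommon hno hb.1 hb.2.1 hc.2.2 hb.2.2

lemma Col.F3 (h : Col G D x y φ) (hno : NoCol G D) {b c : ℕ} (hb : InL D φ y b)
    (hc : InL D φ x c) : y ∈ comp φ b c x := by
  by_contra hy
  have h1 := h.sw (h.comp_cl b c x) hb.1 hc.1 hb.2.1 hc.2.1
  refine h1.nocommon hno hb.1 hb.2.1 ?_ ((miss_sw_out hy).2 hb.2.2)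
  exact (miss_sw_in_left (mem_comp_self b c x)).2 hc.2.2

lemma Col.F1b (h : Col G D x y φ) (hno : NoCol G D) {b l : ℕ} {w : V} (hb : InL D φ y b)
    (hl : InL D φ x l) (hw : φ y w = l) (hm : Miss φ w b) : False := by
  have hw0 : φ y w ≠ 0 := by rw [hw]; exact hl.1
  have h1 := h.recolor hw0 hb.1 hb.2.1 hb.2.2 hm
  have h2 := h.recolor_miss_y hw0 hb.2.2
  rw [hw] at h2
  exact h1.nocommon hno hl.1 hl.2.1 (miss_upd (h.ne_beta hno hb hl) hl.2.2) h2

section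
variable [Fintype V]

/-- a vertex missing an `L`-colour, distinct from `x, y`, is not on the `x`-`y` path -/
lemma Col.notin (h : Col G D x y φ) (hno : NoCol G D) {b c : ℕ} {w : V} (hb : InL D φ y b)
    (hc : InL D φ x c) (hwx : w ≠ x) (hwy : w ≠ y) (hm : Miss φ w c ∨ Miss φ w b) :
    x ∉ comp φ b c w ∧ y ∉ comp φ b c w := by
  have h3 := h.F3 hno hb hc
  have hw : w ∉ comp φ b c x := by
    intro hw
    exact h.three hb.1 hc.1 (mem_comp_self b c x) h3 hw h.ne hwx.symm hwy.symm (Or.inr hc.2.2)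
      (Or.inl hb.2.2) hm.symm
  refine ⟨fun h4 => hw (h.comp_symm h4), fun h4 => hw ?_⟩
  exact comp_trans h3 (h.comp_symm h4)

lemma Col.F1 (h : Col G D x y φ) (hno : NoCol G D) {b l c : ℕ} {w : V} (hb : InL D φ y b)
    (hl : InL D φ x l) (hw : φ y w = l) (hc : c = b ∨ InL D φ x c) (hm : Miss φ w c) : False := by
  rcases hc with rfl | hc
  · exact h.F1b hno hb hl hw hm
  have hwx : w ≠ x := by rintro rfl; rw [h.unc'] at hw; exact hl.1 hw.symm
  have hwy : w ≠ y := by rintro rfl; rw [h.self] at hw; exact hl.1 hw.symm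
  obtain ⟨hx, hy⟩ := h.notin hno hb hc hwx hwy (Or.inl hm)
  have h1 := h.sw (h.comp_cl b c w) hb.1 hc.1 hb.2.1 hc.2.1
  refine h1.F1b hno (hb.sw_out hy) (hl.sw_out hx) (w := w) ?_ ?_
  · rw [Crit.sw_out hy]; exact hw
  · exact (miss_sw_in_left (mem_comp_self b c w)).2 hm

lemma Col.F1' (h : Col G D x y φ) (hno : NoCol G D) {b l₁ l₂ c : ℕ} {w₁ w₂ : V}
    (hb : InL D φ y b) (hl₁ : InL D φ x l₁) (hl₂ : InL D φ x l₂) (hw₁ : φ y w₁ = l₁)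
    (hw₂ : φ y w₂ = l₂) (hne : w₁ ≠ w₂) (hc0 : c ≠ 0) (hcD : c ≤ D)
    (hm₁ : Miss φ w₁ c) (hm₂ : Miss φ w₂ c) : False := by
  have hcb : c ≠ b := by rintro rfl; exact h.F1 hno hb hl₁ hw₁ (Or.inl rfl) hm₁
  have key : ∀ (w : V) (l : ℕ), InL D φ x l → φ y w = l → Miss φ w c → w ∈ comp φ b c y := by
    intro w l hl hw hm
    by_contra hwc
    have hyS : y ∉ comp φ b c w := fun h4 => hwc (h.comp_symm h4)
    have h1 := h.sw (h.comp_cl b c w) hb.1 hc0 hb.2.1 hcD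
    have hlc : l ≠ c := by rintro rfl; exact hm y (by rw [h.symm]; exact hw)
    refine h1.F1b hno (hb.sw_out hyS) (hl.sw_other (h.ne_beta hno hb hl) hlc) (w := w) ?_ ?_
    · rw [Crit.sw_out hyS]; exact hw
    · exact (miss_sw_in_left (mem_comp_self b c w)).2 hm
  have hy₁ : y ≠ w₁ := by rintro rfl; rw [h.self] at hw₁; exact hl₁.1 hw₁.symm
  have hy₂ : y ≠ w₂ := by rintro rfl; rw [h.self] at hw₂; exact hl₂.1 hw₂.symm
  exact h.three hb.1 hc0 (mem_comp_self b c y) (key w₁ l₁ hl₁ hw₁ hm₁) (key w₂ l₂ hl₂ hw₂ hm₂)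
    hy₁ hy₂ hne (Or.inl hb.2.2) (Or.inr hm₁) (Or.inr hm₂)

lemma Col.F2 (h : Col G D x y φ) (hno : NoCol G D) {a l c : ℕ} {z w : V} (ha : InL D φ y a)
    (hz : φ x z = a) (hl : InL D φ x l) (hw : φ z w = l) (hwx : w ≠ x) (hwy : w ≠ y)
    (hc : c = a ∨ InL D φ x c) (hm : Miss φ w c) : False := by
  have hs := h.shift ha.1 hz ha.2.2
  have hxz : x ≠ z := by rintro rfl; rw [h.self] at hz; exact ha.1 hz.symm
  have hzy : z ≠ y := by rintro rfl; rw [h.unc] at hz; exact ha.1 hz.symm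
  have hzw : w ≠ z := by rintro rfl; rw [h.self] at hw; exact hl.1 hw.symm
  have hmz : InL D (upd (upd φ x z 0) x y a) z a := by
    refine ⟨ha.1, ha.2.1, ?_⟩
    intro v hv
    rw [upd_out _ _ hxz.symm hzy] at hv
    by_cases e : v = x
    · subst e; rw [upd_same'] at hv; exact ha.1 hv.symm
    · rw [upd_ne _ _ (by tauto) (by tauto)] at hv
      exact e (h.inj z v x (by rw [hv]; exact ha.1) (by rw [hv, h.symm, hz]))
  have hL : ∀ c, InL D φ x c → InL D (upd (upd φ x z 0) x y a) x c := by
    intro e he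
    have hca : e ≠ a := fun e1 => he.2.2 z (hz.trans e1.symm)
    exact (he.upd he.1).upd hca
  refine hs.F1 hno hmz (hL l hl) (w := w) (c := c) ?_ (hc.imp id (hL c)) ?_
  · rw [upd_out _ _ hxz.symm hzy, upd_ne _ _ (by tauto) (by tauto)]; exact hw
  · rw [miss_upd_out _ _ hwx hwy, miss_upd_out _ _ hwx hzw]; exact hm

/-- the version of `R` with `t` missing `b` -/
lemma Col.Rb (h : Col G D x y φ) (hno : NoCol G D) {b l d : ℕ} {t z w : V} (hb : InL D φ y b)
    (ht : φ y t ≠ 0) (hz : φ x z = φ y t) (hmt : Miss φ t b)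
    (hl : InL D φ x l) (hw : φ z w = l) (hwx : w ≠ x) (hwy : w ≠ y)
    (hd : InL D φ x d) (hm : Miss φ w d) : False := by
  have hc := h.recolor ht hb.1 hb.2.1 hb.2.2 hmt
  have htx : t ≠ x := by rintro rfl; exact ht h.unc'
  have hzy : z ≠ y := by rintro rfl; rw [h.unc] at hz; exact ht hz.symm
  refine hc.F2 hno (a := φ y t) (l := l) (c := d) (z := z) (w := w)
    ⟨ht, h.le _ _, h.recolor_miss_y ht hb.2.2⟩ ?_ (hl.upd (h.ne_beta hno hb hl)) ?_ hwx hwy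
    (Or.inr (hd.upd (h.ne_beta hno hb hd))) (miss_upd (h.ne_beta hno hb hd) hm)
  · rw [upd_out _ _ h.ne htx.symm]; exact hz
  · rw [upd_ne _ _ (by tauto) (by tauto)]; exact hw

lemma Col.R (h : Col G D x y φ) (hno : NoCol G D) {b l d c : ℕ} {t z w : V} (hb : InL D φ y b)
    (ht : φ y t ≠ 0) (hz : φ x z = φ y t) (hmt : Miss φ t c) (hc : c = b ∨ InL D φ x c)
    (hl : InL D φ x l) (hw : φ z w = l) (hwx : w ≠ x) (hwy : w ≠ y)
    (hd : InL D φ x d) (hm : Miss φ w d) (hcl : c ≠ l) (hcd : c ≠ d) : False := by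
  rcases hc with rfl | hc
  · exact h.Rb hno hb ht hz hmt hl hw hwx hwy hd hm
  have htx : t ≠ x := by rintro rfl; exact ht h.unc'
  have hty : t ≠ y := by rintro rfl; exact ht (h.self _)
  obtain ⟨hx, hy⟩ := h.notin hno hb hc htx hty (Or.inl hmt)
  have h1 := h.sw (h.comp_cl b c t) hb.1 hc.1 hb.2.1 hc.2.1
  have hlb := h.ne_beta hno hb hl
  have hdb := h.ne_beta hno hb hd
  refine h1.Rb hno (t := t) (z := z) (w := w) (hb.sw_out hy) ?_ ?_ ?_ (hl.sw_out hx) ?_ hwx hwy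
    (hd.sw_out hx) ((miss_sw_other hdb hcd.symm).2 hm)
  · rw [Crit.sw_out hy]; exact ht
  · rw [Crit.sw_out hy, Crit.sw_out hx]; exact hz
  · exact (miss_sw_in_left (mem_comp_self b c t)).2 hmt
  · rw [Crit.sw_other (by rw [hw]; exact hlb) (by rw [hw]; exact hcl.symm)]; exact hw

/-- slots -/
def Slot (D : ℕ) (φ : V → V → ℕ) (x y : V) (b : ℕ) (F : Finset ℕ) (p : V) : Prop :=
  p = y ∨ φ x p = b ∨ ∃ t c, φ y t ≠ 0 ∧ φ x p = φ y t ∧ Miss φ t c ∧ c ∉ F ∧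
    (c = b ∨ InL D φ x c)

lemma Col.slotFan (h : Col G D x y φ) (hno : NoCol G D) {b l d : ℕ} {p w : V} {F : Finset ℕ}
    (hb : InL D φ y b) (hp : Slot D φ x y b F p) (hlF : l ∈ F) (hdF : d ∈ F)
    (hl : InL D φ x l) (hw : φ p w = l) (hwx : w ≠ x) (hwy : w ≠ y)
    (hd : InL D φ x d) (hm : Miss φ w d) : False := by
  rcases hp with rfl | hp | ⟨t, c, ht, hxp, hmt, hcF, hc⟩
  · exact h.F1 hno hb hl hw (Or.inr hd) hm
  · exact h.F2 hno hb hp hl hw hwx hwy (Or.inr hd) hm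
  · exact h.R hno hb ht hxp hmt hc hl hw hwx hwy hd hm (by rintro rfl; exact hcF hlF)
      (by rintro rfl; exact hcF hdF)

lemma Col.conflict (h : Col G D x y φ) (hno : NoCol G D) {b l c d : ℕ} {p₁ p₂ w₁ w₂ : V}
    {F : Finset ℕ} (hb : InL D φ y b) (hp₁ : Slot D φ x y b F p₁) (hp₂ : Slot D φ x y b F p₂)
    (hp : p₁ ≠ p₂) (hlF : l ∈ F) (hcF : c ∈ F) (hdF : d ∈ F) (hl0 : l ≠ 0) (hlb : l ≠ b)
    (hw₁ : φ p₁ w₁ = l) (hw₂ : φ p₂ w₂ = l) (hx₁ : w₁ ≠ x) (hx₂ : w₂ ≠ x)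
    (hy₁ : w₁ ≠ y) (hy₂ : w₂ ≠ y) (hc : InL D φ x c) (hd : InL D φ x d) (hcd : c ≠ d)
    (hmc₁ : Miss φ w₁ c) (hmc₂ : Miss φ w₂ c) (hmd₁ : Miss φ w₁ d) (hmd₂ : Miss φ w₂ d) :
    False := by
  have hlD : l ≤ D := by rw [← hw₁]; exact h.le _ _
  have hww : w₁ ≠ w₂ := by
    rintro rfl
    apply hp
    apply h.inj w₁ p₁ p₂
    · rw [h.symm, hw₁]; exact hl0
    · rw [h.symm, hw₁, h.symm, hw₂]
  have hdl : d ≠ l := by rintro rfl; exact hmd₁ p₁ (by rw [h.symm]; exact hw₁)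
  have hcl : c ≠ l := by rintro rfl; exact hmc₁ p₁ (by rw [h.symm]; exact hw₁)
  have key : ∀ p w : V, Slot D φ x y b F p → φ p w = l → w ≠ x → w ≠ y → Miss φ w d →
      w ∈ comp φ l c x := by
    intro p w hp hw hwx hwy hm
    by_contra hwS
    have h1 := h.sw (h.comp_cl l c x) hl0 hc.1 hlD hc.2.1
    have hcb := h.ne_beta hno hb hc
    refine h1.slotFan hno (l := l) (d := d) (w := w) (hb.sw_other hlb.symm hcb.symm)
      (p := p) (F := F) ?_ hlF hdF ?_ ?_ hwx hwy (hd.sw_other hdl hcd.symm) ?_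
    · rcases hp with rfl | hp | ⟨t, e, ht, hxp, hmt, heF, he⟩
      · exact Or.inl rfl
      · refine Or.inr (Or.inl ?_)
        rw [Crit.sw_other (by rw [hp]; exact hlb.symm) (by rw [hp]; exact hcb.symm)]; exact hp
      · refine Or.inr (Or.inr ⟨t, e, ?_⟩)
        have hl' : φ x p ≠ l := by
          intro e1
          apply hwx
          refine (h.inj p x w ?_ ?_).symm
          · rw [h.symm, hxp]; exact ht
          · rw [h.symm, e1, hw]
        have hc' : φ x p ≠ c := hc.2.2 p
        have hel : e ≠ l := by rintro rfl; exact heF hlF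
        have hec : e ≠ c := by rintro rfl; exact heF hcF
        have e1 : Crit.sw φ (comp φ l c x) l c y t = φ y t :=
          Crit.sw_other (by rw [← hxp]; exact hl') (by rw [← hxp]; exact hc')
        refine ⟨?_, ?_, (miss_sw_other hel hec).2 hmt, heF, he.imp id (fun h => h.sw_other hel hec)⟩
        · rw [e1]; exact ht
        · rw [e1, Crit.sw_other hl' hc']; exact hxp
    · exact ⟨hl0, hlD, (miss_sw_in_left (mem_comp_self l c x)).2 hc.2.2⟩
    · rw [h1.symm, Crit.sw_out hwS, h.symm]; exact hw
    · exact (miss_sw_other hdl hcd.symm).2 hm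
  exact h.three hl0 hc.1 (mem_comp_self l c x) (key p₁ w₁ hp₁ hw₁ hx₁ hy₁ hmd₁)
    (key p₂ w₂ hp₂ hw₂ hx₂ hy₂ hmd₂) hx₁.symm hx₂.symm hww (Or.inr hc.2.2) (Or.inr hmc₁)
    (Or.inr hmc₂)

end

lemma Col.ii1 [Fintype V] (h : Col G D x y φ) (hno : NoCol G D) {b c d : ℕ} {t z w : V}
    (hb : InL D φ y b) (ht : φ y t ≠ 0) (hz : φ x z = φ y t) (hmt : Miss φ t b) (hw : φ z w = b)
    (hwx : w ≠ x) (hwy : w ≠ y) (hc : InL D φ x c) (hd : InL D φ x d) (hcd : c ≠ d)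
    (htc : Miss φ t c) (htd : Miss φ t d) (hwc : Miss φ w c) (hwd : Miss φ w d) : False := by
  have htx : t ≠ x := by rintro rfl; exact ht h.unc'
  have hty : t ≠ y := by rintro rfl; exact ht (h.self _)
  have hzy : z ≠ y := by rintro rfl; rw [h.unc] at hz; exact ht hz.symm
  have h1 := h.recolor ht hb.1 hb.2.1 hb.2.2 hmt
  have hcb := h.ne_beta hno hb hc
  have hdb := h.ne_beta hno hb hd
  have hbt : b ≠ φ y t := fun e => hb.2.2 t e.symm
  refine h1.conflict hno (b := φ y t) (l := b) (c := c) (d := d) (p₁ := y) (p₂ := z) (w₁ := t)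
    (w₂ := w) (F := {b, c, d}) ⟨ht, h.le _ _, h.recolor_miss_y ht hb.2.2⟩ (Or.inl rfl)
    (Or.inr (Or.inl ?_)) hzy.symm (by simp) (by simp) (by simp) hb.1 hbt (upd_same _ _ _ _) ?_
    htx hwx hty hwy (hc.upd hcb) (hd.upd hdb) hcd (miss_upd hcb htc) (miss_upd hcb hwc)
    (miss_upd hdb htd) (miss_upd hdb hwd)
  · rw [upd_out _ _ h.ne htx.symm]; exact hz
  · rw [upd_ne _ _ (by tauto) (by tauto)]; exact hw

lemma Col.ii [Fintype V] (h : Col G D x y φ) (hno : NoCol G D) {b e c d : ℕ} {t z w : V}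
    (hb : InL D φ y b) (ht : φ y t ≠ 0) (hz : φ x z = φ y t) (hw : φ z w = b)
    (hwx : w ≠ x) (hwy : w ≠ y) (he : InL D φ x e) (hc : InL D φ x c) (hd : InL D φ x d)
    (hcd : c ≠ d) (hec : c ≠ e) (hed : d ≠ e)
    (hte : Miss φ t e) (htc : Miss φ t c) (htd : Miss φ t d) (hwc : Miss φ w c)
    (hwd : Miss φ w d) : False := by
  have htx : t ≠ x := by rintro rfl; exact ht h.unc'
  have hty : t ≠ y := by rintro rfl; exact ht (h.self _)
  obtain ⟨hx, hy⟩ := h.notin hno hb he htx hty (Or.inl hte)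
  have h1 := h.sw (h.comp_cl b e t) hb.1 he.1 hb.2.1 he.2.1
  have hcb := h.ne_beta hno hb hc
  have hdb := h.ne_beta hno hb hd
  have a1 : InL D (Crit.sw φ (comp φ b e t) b e) y b := hb.sw_out hy
  have a2 : Crit.sw φ (comp φ b e t) b e y t = φ y t := sw_out hy _
  have a3 : Crit.sw φ (comp φ b e t) b e x z = Crit.sw φ (comp φ b e t) b e y t := by
    rw [sw_out hx, a2]; exact hz
  have a4 : Miss (Crit.sw φ (comp φ b e t) b e) t b := (miss_sw_in_left (mem_comp_self b e t)).2 hte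
  have a5 : Crit.sw φ (comp φ b e t) b e y t ≠ 0 := by rw [a2]; exact ht
  by_cases hzS : z ∈ comp φ b e t
  · refine h1.Rb hno (l := e) (d := d) a1 a5 a3 a4 (he.sw_out hx) (w := w) ?_ hwx hwy
      (hd.sw_out hx) ((miss_sw_other hdb hed).2 hwd)
    rw [sw_in hzS, hw, Equiv.swap_apply_left]
  · refine h1.ii1 hno a1 a5 a3 a4 (w := w) ?_ hwx hwy (hc.sw_out hx) (hd.sw_out hx) hcd
      ((miss_sw_other hcb hec).2 htc) ((miss_sw_other hdb hed).2 htd)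
      ((miss_sw_other hcb hec).2 hwc) ((miss_sw_other hdb hed).2 hwd)
    rw [sw_out hzS]; exact hw

open Classical in
/-- finset of missing colours -/
noncomputable def ms (D : ℕ) (φ : V → V → ℕ) (v : V) : Finset ℕ :=
  (Finset.Icc 1 D).filter (fun c => Miss φ v c)

lemma mem_ms {v : V} {c : ℕ} : c ∈ ms D φ v ↔ InL D φ v c := by
  simp only [ms, mem_filter, mem_Icc, InL]
  constructor
  · rintro ⟨⟨h1, h2⟩, h3⟩; exact ⟨by omega, h2, h3⟩
  · rintro ⟨h1, h2, h3⟩; exact ⟨⟨by omega, h2⟩, h3⟩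

lemma ms_sub (D : ℕ) (φ : V → V → ℕ) (v : V) : ms D φ v ⊆ Finset.Icc 1 D := by
  classical
  intro c hc
  rw [mem_ms] at hc
  exact mem_Icc.2 ⟨Nat.pos_of_ne_zero hc.1, hc.2.1⟩

lemma card_inter {D n : ℕ} {A B : Finset ℕ} (hA : A ⊆ Finset.Icc 1 D) (hB : B ⊆ Finset.Icc 1 D)
    (hn : D + n ≤ A.card + B.card) : n ≤ (A ∩ B).card := by
  have h1 := card_union_add_card_inter A B
  have h2 := card_le_card (union_subset hA hB)
  simp at h2
  omega

lemma card_inter3 {D n : ℕ} {A B C : Finset ℕ} (hA : A ⊆ Finset.Icc 1 D)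
    (hB : B ⊆ Finset.Icc 1 D) (hC : C ⊆ Finset.Icc 1 D)
    (hn : 2 * D + n ≤ A.card + B.card + C.card) : n ≤ (A ∩ (B ∩ C)).card := by
  have h1 := card_union_add_card_inter B C
  have h2 := card_le_card (union_subset hB hC)
  simp at h2
  refine card_inter hA (inter_subset_left.trans hB) ?_
  omega

lemma exists_notin {A F : Finset ℕ} (h : F.card < A.card) : ∃ c ∈ A, c ∉ F := by
  by_contra hc
  push Not at hc
  exact absurd (card_le_card (fun c h => hc c h)) (by omega)

lemma exists_two {A F : Finset ℕ} (h : F.card + 1 < A.card) :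
    ∃ c ∈ A, ∃ d ∈ A, c ≠ d ∧ c ∉ F ∧ d ∉ F := by
  obtain ⟨c, hc, hcF⟩ := exists_notin (A := A) (F := F) (by omega)
  obtain ⟨d, hd, hdF⟩ := exists_notin (A := A) (F := insert c F)
    (lt_of_le_of_lt (card_insert_le _ _) h)
  simp only [mem_insert, not_or] at hdF
  exact ⟨c, hc, d, hd, fun e => hdF.1 e.symm, hcF, hdF.2⟩

section
variable [Fintype V]

lemma Col.card_ms (h : Col G D x y φ) (v : V) :
    (ms D φ v).card + (univ.filter (fun w => φ v w ≠ 0)).card = D := by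
  classical
  have h1 : (univ.filter (fun w => φ v w ≠ 0)).card =
      ((Finset.Icc 1 D).filter (fun c => ¬ Miss φ v c)).card := by
    rw [← card_image_of_injOn (s := univ.filter (fun w => φ v w ≠ 0)) (f := φ v)]
    · congr 1
      ext c
      simp only [mem_image, mem_filter, mem_univ, true_and, mem_Icc, Miss, not_forall, not_not]
      constructor
      · rintro ⟨w, h1, rfl⟩
        exact ⟨⟨Nat.pos_of_ne_zero h1, h.le _ _⟩, w, rfl⟩
      · rintro ⟨⟨h1, h2⟩, w, rfl⟩
        exact ⟨w, by omega, rfl⟩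
    · intro w hw w' hw' e
      simp only [coe_filter, mem_univ, true_and, Set.mem_ofPred_eq] at hw
      exact h.inj v w w' hw e
  rw [h1]
  have := card_filter_add_card_filter_not (s := Finset.Icc 1 D) (fun c => Miss φ v c)
  rw [Nat.card_Icc, Nat.add_sub_cancel] at this
  unfold ms
  convert this using 1

variable [DecidableRel G.Adj]

lemma Col.card_ms_other (h : Col G D x y φ) {v : V} (hx : v ≠ x) (hy : v ≠ y) :
    (ms D φ v).card + G.degree v = D := by
  have h0 := h.card_ms v
  rw [← G.card_neighborFinset_eq_degree]
  suffices e : G.neighborFinset v = univ.filter (fun w => φ v w ≠ 0) by rw [e]; exact h0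
  ext w
  simp only [SimpleGraph.mem_neighborFinset, mem_filter, mem_univ, true_and]
  constructor
  · intro h1 h2
    rcases h.col v w h1 h2 with ⟨e, _⟩ | ⟨e, _⟩
    · exact hx e
    · exact hy e
  · exact h.adj v w

lemma Col.card_ms_x (h : Col G D x y φ) : (ms D φ x).card + G.degree x = D + 1 := by
  classical
  have h0 := h.card_ms x
  rw [← G.card_neighborFinset_eq_degree]
  have : univ.filter (fun w => φ x w ≠ 0) = (G.neighborFinset x).erase y := by
    ext w
    simp only [SimpleGraph.mem_neighborFinset, mem_filter, mem_univ, true_and, mem_erase]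
    constructor
    · intro h1
      refine ⟨?_, h.adj x w h1⟩
      rintro rfl; exact h1 h.unc
    · rintro ⟨h1, h2⟩ h3
      rcases h.col x w h2 h3 with ⟨_, e⟩ | ⟨e, _⟩
      · exact h1 e
      · exact h.ne e
  rw [this] at h0
  have h2 : y ∈ G.neighborFinset x := by simpa using h.xy
  have h3 := card_erase_add_one h2
  omega

lemma Col.card_ms_y (h : Col G D x y φ) : (ms D φ y).card + G.degree y = D + 1 := by
  classical
  have h0 := h.card_ms y
  rw [← G.card_neighborFinset_eq_degree]
  have : univ.filter (fun w => φ y w ≠ 0) = (G.neighborFinset y).erase x := by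
    ext w
    simp only [SimpleGraph.mem_neighborFinset, mem_filter, mem_univ, true_and, mem_erase]
    constructor
    · intro h1
      refine ⟨?_, h.adj y w h1⟩
      rintro rfl; exact h1 h.unc'
    · rintro ⟨h1, h2⟩ h3
      rcases h.col y w h2 h3 with ⟨e, _⟩ | ⟨_, e⟩
      · exact h.ne e.symm
      · exact h1 e
  rw [this] at h0
  have h2 : x ∈ G.neighborFinset y := by simpa using h.xy.symm
  have h3 := card_erase_add_one h2
  omega

lemma Col.exists_beta (h : Col G D x y φ) (hdeg : ∀ v, G.degree v ≤ D) : ∃ b, InL D φ y b := by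
  have h1 := h.card_ms_y
  have h2 := hdeg y
  have : 0 < (ms D φ y).card := by omega
  obtain ⟨b, hb⟩ := card_pos.1 this
  exact ⟨b, mem_ms.1 hb⟩

open Classical in
/-- the `L`-coloured neighbours of `y` -/
noncomputable def PL (D : ℕ) (φ : V → V → ℕ) (x y : V) : Finset V :=
  univ.filter (fun w => InL D φ x (φ y w))

lemma mem_PL {w : V} : w ∈ PL D φ x y ↔ InL D φ x (φ y w) := by simp [PL]

lemma Col.PLprop (h : Col G D x y φ) (hno : NoCol G D) (hdeg : ∀ v, G.degree v ≤ D) :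
    PL D φ x y ⊆ G.neighborFinset y ∧ x ∉ PL D φ x y ∧
    (PL D φ x y).card + G.degree x = D + 1 ∧
    ∑ w ∈ PL D φ x y, (D - G.degree w) + 2 ≤ G.degree x := by
  classical
  obtain ⟨b, hb⟩ := h.exists_beta hdeg
  have hsub : PL D φ x y ⊆ G.neighborFinset y := by
    intro w hw
    rw [mem_PL] at hw
    rw [SimpleGraph.mem_neighborFinset]
    exact h.adj _ _ hw.1
  have hxP : x ∉ PL D φ x y := by
    intro hw
    rw [mem_PL, h.unc'] at hw
    exact hw.1 rfl
  have hyP : y ∉ PL D φ x y := by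
    intro hw
    rw [mem_PL, h.self] at hw
    exact hw.1 rfl
  have hcard : (PL D φ x y).card = (ms D φ x).card := by
    rw [← card_image_of_injOn (s := PL D φ x y) (f := φ y)]
    · congr 1
      ext c
      simp only [mem_image, mem_PL, mem_ms]
      constructor
      · rintro ⟨w, h1, rfl⟩; exact h1
      · intro hc
        by_contra hn
        push Not at hn
        refine h.nocommon hno hc.1 hc.2.1 hc.2.2 ?_
        intro w hw
        exact hn w (by rw [hw]; exact hc) hw
    · intro w hw w' hw' e
      exact h.inj y w w' (mem_PL.1 hw).1 e
  have hx := h.card_ms_x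
  refine ⟨hsub, hxP, by omega, ?_⟩
  have h1 : ∑ w ∈ PL D φ x y, (D - G.degree w) = ∑ w ∈ PL D φ x y, (ms D φ w).card := by
    apply sum_congr rfl
    intro w hw
    have := h.card_ms_other (v := w) (by rintro rfl; exact hxP hw) (by rintro rfl; exact hyP hw)
    omega
  have h2 : ∑ w ∈ PL D φ x y, (ms D φ w).card = ((PL D φ x y).biUnion (ms D φ)).card := by
    symm
    apply card_biUnion
    intro w₁ hw₁ w₂ hw₂ hne
    rw [Function.onFun, disjoint_left]
    intro c hc₁ hc₂
    rw [mem_ms] at hc₁ hc₂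
    exact h.F1' hno hb (mem_PL.1 hw₁) (mem_PL.1 hw₂) rfl rfl hne hc₁.1 hc₁.2.1 hc₁.2.2 hc₂.2.2
  have h3 : (PL D φ x y).biUnion (ms D φ) ⊆ ((Finset.Icc 1 D) \ ms D φ x).erase b := by
    intro c hc
    rw [mem_biUnion] at hc
    obtain ⟨w, hw, hc⟩ := hc
    rw [mem_erase, mem_sdiff]
    refine ⟨?_, ms_sub _ _ _ hc, ?_⟩
    · rintro rfl
      exact h.F1 hno hb (mem_PL.1 hw) rfl (Or.inl rfl) (mem_ms.1 hc).2.2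
    · intro hcx
      exact h.F1 hno hb (mem_PL.1 hw) rfl (Or.inr (mem_ms.1 hcx)) (mem_ms.1 hc).2.2
  have h4 := card_le_card h3
  have hbm : b ∈ (Finset.Icc 1 D) \ ms D φ x := by
    rw [mem_sdiff, mem_Icc]
    refine ⟨⟨Nat.pos_of_ne_zero hb.1, hb.2.1⟩, ?_⟩
    intro hbx
    exact h.ne_beta hno hb (mem_ms.1 hbx) rfl
  have h5 := card_erase_add_one hbm
  have h6 := card_sdiff_add_card_eq_card (ms_sub D φ x)
  rw [Nat.card_Icc] at h6
  omega

end

section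
variable [Fintype V] [DecidableRel G.Adj]

open Classical in
/-- neighbours of `y` in `X` of degree at most `67 D / 100` -/
noncomputable def lowN (G : SimpleGraph V) [DecidableRel G.Adj] (X : Finset V) (D : ℕ) (y : V) :
    Finset V := univ.filter (fun v => v ∈ X ∧ G.Adj y v ∧ 100 * G.degree v ≤ 67 * D)

open Classical in
/-- neighbours of `y` in `X` of degree less than `10^13` -/
noncomputable def tinyN (G : SimpleGraph V) [DecidableRel G.Adj] (X : Finset V) (y : V) :
    Finset V := univ.filter (fun v => v ∈ X ∧ G.Adj y v ∧ G.degree v < 10 ^ 13)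

lemma mem_lowN {X : Finset V} {v : V} :
    v ∈ lowN G X D y ↔ v ∈ X ∧ G.Adj y v ∧ 100 * G.degree v ≤ 67 * D := by simp [lowN]

lemma mem_tinyN {X : Finset V} {v : V} :
    v ∈ tinyN G X y ↔ v ∈ X ∧ G.Adj y v ∧ G.degree v < 10 ^ 13 := by simp [tinyN]

lemma tiny_sub_low {X : Finset V} (hD : 5 ^ 25 ≤ D) : tinyN G X y ⊆ lowN G X D y := by
  intro v hv
  rw [mem_tinyN] at hv
  rw [mem_lowN]
  refine ⟨hv.1, hv.2.1, ?_⟩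
  norm_num at hD hv
  omega

lemma Col.low_common (h : Col G D x y φ) (hD : 5 ^ 25 ≤ D) (hk : G.degree x < 10 ^ 13) {t : V}
    (ht : 100 * G.degree t ≤ 67 * D) (htx : t ≠ x) (hty : t ≠ y) :
    10 ≤ (ms D φ t ∩ ms D φ x).card := by
  have h1 := h.card_ms_other htx hty
  have h2 := h.card_ms_x
  refine card_inter (ms_sub _ _ _) (ms_sub _ _ _) ?_
  norm_num at hD hk
  omega

lemma Col.low_tiny_common (h : Col G D x y φ) (hD : 5 ^ 25 ≤ D) (hk : G.degree x < 10 ^ 13)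
    {t w : V} (ht : 100 * G.degree t ≤ 67 * D) (htx : t ≠ x) (hty : t ≠ y)
    (hw : G.degree w < 10 ^ 13) (hwx : w ≠ x) (hwy : w ≠ y) :
    10 ≤ (ms D φ t ∩ (ms D φ w ∩ ms D φ x)).card := by
  have h1 := h.card_ms_other htx hty
  have h2 := h.card_ms_x
  have h3 := h.card_ms_other hwx hwy
  refine card_inter3 (ms_sub _ _ _) (ms_sub _ _ _) (ms_sub _ _ _) ?_
  norm_num at hD hk hw
  omega

/-- Lemma E -/
lemma Col.lemE (h : Col G D x y φ) (hno : NoCol G D) (hdeg : ∀ v, G.degree v ≤ D)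
    (hD : 5 ^ 25 ≤ D) {X : Finset V} (hX : ∀ u ∈ X, ∀ v ∈ X, u ≠ v → ¬ G.Adj u v) (hx : x ∈ X)
    (hk : G.degree x < 10 ^ 13) :
    ∃ Z ⊆ G.neighborFinset x, y ∉ Z ∧ Z.card = (lowN G X D y).card ∧
      ∑ z ∈ Z, (tinyN G X z).card + 1 ≤ G.degree x := by
  classical
  obtain ⟨b, hb⟩ := h.exists_beta hdeg
  have hyX : y ∉ X := fun hy => hX x hx y hy h.ne h.xy
  set T := (lowN G X D y).erase x with hT
  have hTm : ∀ t ∈ T, t ≠ x ∧ t ≠ y ∧ φ y t ≠ 0 ∧ 100 * G.degree t ≤ 67 * D := by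
    intro t ht
    rw [hT, mem_erase, mem_lowN] at ht
    have hty : t ≠ y := by rintro rfl; exact hyX ht.2.1
    refine ⟨ht.1, hty, ?_, ht.2.2.2⟩
    intro h0
    rcases h.col y t ht.2.2.1 h0 with ⟨e, _⟩ | ⟨_, e⟩
    · exact h.ne e.symm
    · exact ht.1 e
  have hxl : x ∈ lowN G X D y := by
    rw [mem_lowN]
    refine ⟨hx, h.xy.symm, ?_⟩
    norm_num at hD hk; omega
  have hTc : T.card + 1 = (lowN G X D y).card := card_erase_add_one hxl
  set A := insert b (T.image (φ y)) with hA
  have hbT : b ∉ T.image (φ y) := by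
    intro hbm
    obtain ⟨t, _, e⟩ := mem_image.1 hbm
    exact hb.2.2 t e
  have hAc : A.card = (lowN G X D y).card := by
    rw [hA, card_insert_of_notMem hbT, card_image_of_injOn, hTc]
    intro t ht t' ht' e
    exact h.inj y t t' (hTm t ht).2.2.1 e
  -- `A` is present at `x`
  have hAK : ∀ a ∈ A, ∃ z, φ x z = a := by
    intro a ha
    by_contra hn
    push Not at hn
    rw [hA, mem_insert, mem_image] at ha
    rcases ha with rfl | ⟨t, ht, rfl⟩
    · exact h.nocommon hno hb.1 hb.2.1 hn hb.2.2
    · obtain ⟨h1, h2, h3, h4⟩ := hTm t ht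
      have h5 := h.low_common hD hk h4 h1 h2
      obtain ⟨c, hc⟩ := card_pos.1 (show 0 < (ms D φ t ∩ ms D φ x).card by omega)
      rw [mem_inter, mem_ms, mem_ms] at hc
      exact h.F1 hno hb ⟨h3, h.le _ _, hn⟩ rfl (Or.inr hc.2) hc.1.2.2
  have : Nonempty V := ⟨x⟩
  choose! zf hzf using hAK
  have hA0 : ∀ a ∈ A, a ≠ 0 := by
    intro a ha
    rw [hA, mem_insert, mem_image] at ha
    rcases ha with rfl | ⟨t, ht, rfl⟩
    · exact hb.1
    · exact (hTm t ht).2.2.1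
  have hzinj : ∀ a ∈ A, ∀ a' ∈ A, zf a = zf a' → a = a' := by
    intro a ha a' ha' e
    rw [← hzf a ha, ← hzf a' ha', e]
  have hzadj : ∀ a ∈ A, G.Adj x (zf a) := by
    intro a ha
    apply h.adj
    rw [hzf a ha]; exact hA0 a ha
  have hzy : ∀ a ∈ A, zf a ≠ y := by
    intro a ha e
    have := hzf a ha
    rw [e, h.unc] at this
    exact hA0 a ha this.symm
  -- slots
  have hslot : ∀ a ∈ A, ∀ F : Finset ℕ, F.card ≤ 3 → Slot D φ x y b F (zf a) := by
    intro a ha F hF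
    have hz := hzf a ha
    have ha' := ha
    rw [hA, mem_insert, mem_image] at ha
    rcases ha with e | ⟨t, ht, e⟩
    · exact Or.inr (Or.inl (by rw [hz, e]))
    · obtain ⟨h1, h2, h3, h4⟩ := hTm t ht
      have h5 := h.low_common hD hk h4 h1 h2
      obtain ⟨c, hc, hcF⟩ := exists_notin (A := ms D φ t ∩ ms D φ x) (F := F) (by omega)
      rw [mem_inter, mem_ms, mem_ms] at hc
      exact Or.inr (Or.inr ⟨t, c, h3, by rw [hz, e], hc.1.2.2, hcF, Or.inr hc.2⟩)
  have hwm : ∀ a ∈ A, ∀ w ∈ (tinyN G X (zf a)).erase x,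
      w ≠ x ∧ w ≠ y ∧ G.degree w < 10 ^ 13 ∧ φ (zf a) w ≠ 0 := by
    intro a ha w hw
    rw [mem_erase, mem_tinyN] at hw
    have hwy : w ≠ y := by rintro rfl; exact hyX hw.2.1
    refine ⟨hw.1, hwy, hw.2.2.2, ?_⟩
    intro h0
    rcases h.col _ w hw.2.2.1 h0 with ⟨_, e⟩ | ⟨_, e⟩
    · exact hwy e
    · exact hw.1 e
  have hlowx : ∀ w, G.degree w < 10 ^ 13 → 100 * G.degree w ≤ 67 * D := by
    intro w hw
    norm_num at hD hw
    omega
  have hb2 : ∀ a ∈ A, ∀ w ∈ (tinyN G X (zf a)).erase x, φ (zf a) w ≠ b := by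
    intro a ha w hw e
    obtain ⟨h1, h2, h3, h4⟩ := hwm a ha w hw
    have hz := hzf a ha
    have ha' := ha
    rw [hA, mem_insert, mem_image] at ha
    rcases ha with e' | ⟨t, ht, e'⟩
    · apply h1
      apply h.inj (zf a) w x h4
      rw [e, h.symm, hz, e']
    · obtain ⟨t1, t2, t3, t4⟩ := hTm t ht
      have t5 := h.low_common hD hk t4 t1 t2
      have t6 := h.low_tiny_common hD hk t4 t1 t2 h3 h1 h2
      obtain ⟨e1, he1⟩ := card_pos.1 (show 0 < (ms D φ t ∩ ms D φ x).card by omega)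
      obtain ⟨c, hc, d, hd, hcd, hce, hde⟩ := exists_two
        (A := ms D φ t ∩ (ms D φ w ∩ ms D φ x)) (F := {e1}) (by rw [card_singleton]; omega)
      simp only [mem_inter, mem_ms, mem_singleton] at hc hd hce hde he1
      exact h.ii hno hb t3 (by rw [hz, e']) e h1 h2 he1.2 hc.2.2 hd.2.2 hcd hce hde
        he1.1.2.2 hc.1.2.2 hd.1.2.2 hc.2.1.2.2 hd.2.1.2.2
  have hA2 : ∀ a ∈ A, ∀ w ∈ (tinyN G X (zf a)).erase x, φ (zf a) w ∉ A := by
    intro a ha w hw hm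
    have hne := hb2 a ha w hw
    obtain ⟨h1, h2, h3, h4⟩ := hwm a ha w hw
    rw [hA, mem_insert, mem_image] at hm
    rcases hm with e | ⟨t, ht, e⟩
    · exact hne e
    obtain ⟨t1, t2, t3, t4⟩ := hTm t ht
    have t6 := h.low_tiny_common hD hk t4 t1 t2 h3 h1 h2
    obtain ⟨c, hc, d, hd, hcd, -, -⟩ := exists_two
        (A := ms D φ t ∩ (ms D φ w ∩ ms D φ x)) (F := ∅) (by rw [card_empty]; omega)
    simp only [mem_inter, mem_ms] at hc hd
    exact h.conflict hno (l := φ (zf a) w) (F := {φ (zf a) w, c, d}) hb (Or.inl rfl)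
      (hslot a ha _ card_le_three) (hzy a ha).symm (by simp) (by simp) (by simp) h4 hne e rfl
      t1 h1 t2 h2 hc.2.2 hd.2.2 hcd hc.1.2.2 hc.2.1.2.2 hd.1.2.2 hd.2.1.2.2
  have hL2 : ∀ a ∈ A, ∀ w ∈ (tinyN G X (zf a)).erase x, φ (zf a) w ∉ ms D φ x := by
    intro a ha w hw hm
    obtain ⟨h1, h2, h3, h4⟩ := hwm a ha w hw
    have t5 := h.low_common hD hk (hlowx w h3) h1 h2
    obtain ⟨d, hd⟩ := card_pos.1 (show 0 < (ms D φ w ∩ ms D φ x).card by omega)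
    rw [mem_inter, mem_ms, mem_ms] at hd
    exact h.slotFan hno hb (hslot a ha {φ (zf a) w, d, 0} card_le_three) (by simp) (by simp)
      (mem_ms.1 hm) rfl h1 h2 hd.2 hd.1.2.2
  have hinj : ∀ a ∈ A, ∀ w ∈ (tinyN G X (zf a)).erase x, ∀ a' ∈ A,
      ∀ w' ∈ (tinyN G X (zf a')).erase x, φ (zf a) w = φ (zf a') w' → a = a' := by
    intro a ha w hw a' ha' w' hw' e
    by_contra hne
    obtain ⟨h1, h2, h3, h4⟩ := hwm a ha w hw
    obtain ⟨t1, t2, t3, t4⟩ := hwm a' ha' w' hw'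
    have t6 := h.low_tiny_common hD hk (hlowx w' t3) t1 t2 h3 h1 h2
    obtain ⟨c, hc, d, hd, hcd, -, -⟩ := exists_two
        (A := ms D φ w' ∩ (ms D φ w ∩ ms D φ x)) (F := ∅) (by rw [card_empty]; omega)
    simp only [mem_inter, mem_ms] at hc hd
    exact h.conflict hno (l := φ (zf a) w) (F := {φ (zf a) w, c, d}) hb
      (hslot a' ha' _ card_le_three)
      (hslot a ha _ card_le_three) (fun e1 => hne (hzinj _ ha' _ ha e1).symm)
      (by simp) (by simp) (by simp) h4 (hb2 a ha w hw) e.symm rfl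
      t1 h1 t2 h2 hc.2.2 hd.2.2 hcd hc.1.2.2 hc.2.1.2.2 hd.1.2.2 hd.2.1.2.2
  refine ⟨A.image zf, ?_, ?_, ?_, ?_⟩
  · intro z hz
    obtain ⟨a, ha, rfl⟩ := mem_image.1 hz
    simpa using hzadj a ha
  · intro hy
    obtain ⟨a, ha, e⟩ := mem_image.1 hy
    exact hzy a ha e
  · rw [card_image_of_injOn, hAc]
    intro a ha a' ha' e
    exact hzinj a ha a' ha' e
  · rw [sum_image (fun a ha a' ha' e => hzinj a ha a' ha' e)]
    have e1 : ∑ a ∈ A, (tinyN G X (zf a)).card ≤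
        ∑ a ∈ A, (((tinyN G X (zf a)).erase x).card + 1) := by
      apply sum_le_sum
      intro a _
      have := pred_card_le_card_erase (s := tinyN G X (zf a)) (a := x)
      omega
    have e2 : ∑ a ∈ A, ((tinyN G X (zf a)).erase x).card =
        (A.sigma (fun a => (tinyN G X (zf a)).erase x)).card := by
      rw [card_sigma]
    have e3 : (A.sigma (fun a => (tinyN G X (zf a)).erase x)).card ≤
        (((Finset.Icc 1 D) \ ms D φ x) \ A).card := by
      apply card_le_card_of_injOn (fun p => φ (zf p.1) p.2)
      · rintro ⟨a, w⟩ hp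
        simp only [coe_sigma, Set.mem_sigma_iff, mem_coe] at hp
        obtain ⟨ha, hw⟩ := hp
        rw [mem_coe, mem_sdiff, mem_sdiff, mem_Icc]
        exact ⟨⟨⟨Nat.pos_of_ne_zero (hwm a ha w hw).2.2.2, h.le _ _⟩, hL2 a ha w hw⟩,
          hA2 a ha w hw⟩
      · rintro ⟨a, w⟩ hp ⟨a', w'⟩ hp' e
        simp only [coe_sigma, Set.mem_sigma_iff, mem_coe] at hp hp' e
        obtain ⟨ha, hw⟩ := hp
        obtain ⟨ha', hw'⟩ := hp'
        have e1 := hinj a ha w hw a' ha' w' hw' e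
        subst e1
        have e2 := h.inj (zf a) w w' (hwm a ha w hw).2.2.2 e
        subst e2
        rfl
    have hAsub : A ⊆ (Finset.Icc 1 D) \ ms D φ x := by
      intro a ha
      rw [mem_sdiff, mem_Icc, mem_ms]
      refine ⟨⟨Nat.pos_of_ne_zero (hA0 a ha), ?_⟩, ?_⟩
      · rw [← hzf a ha]; exact h.le _ _
      · intro hL; exact hL.2.2 _ (hzf a ha)
    have e4 := card_sdiff_add_card_eq_card hAsub
    have e5 := card_sdiff_add_card_eq_card (ms_sub D φ x)
    rw [Nat.card_Icc] at e5
    have e6 := h.card_ms_x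
    rw [sum_add_distrib, sum_const, smul_eq_mul, mul_one, e2] at e1
    have e7 := hdeg x
    have e8 : 1 ≤ G.degree x := by
      rw [← G.card_neighborFinset_eq_degree]
      exact card_pos.2 ⟨y, by simpa using h.xy⟩
    omega

end

/-- `u` misses `b` or at least `n` colours missing at `x` -/
def Able (D : ℕ) (φ : V → V → ℕ) (x : V) (b n : ℕ) (u : V) : Prop :=
  Miss φ u b ∨ n ≤ (ms D φ u ∩ ms D φ x).card

/-- configuration for Lemma M -/
def Conf (D : ℕ) (φ : V → V → ℕ) (x y : V) (b l : ℕ) (I : Finset ℕ) (t z w : ℕ → V) (n : ℕ) :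
    Prop :=
  ∀ a ∈ I, a ≠ 0 ∧ φ y (t a) = a ∧ φ x (z a) = a ∧ φ (z a) (w a) = l ∧ w a ≠ x ∧ w a ≠ y ∧
    Able D φ x b n (t a)

lemma ms_congr {φ' : V → V → ℕ} {v : V} (h : ∀ u, φ' v u = φ v u) : ms D φ' v = ms D φ v := by
  ext c
  simp [mem_ms, InL, Miss, h]

lemma InL_congr {φ' : V → V → ℕ} {v : V} (h : ∀ u, φ' v u = φ v u) {c : ℕ} :
    InL D φ' v c ↔ InL D φ v c := by
  simp [InL, Miss, h]

lemma Able.weak {b n : ℕ} {u : V} (h : Able D φ x b n u) (F : Finset ℕ) (hF : F.card < n) :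
    Miss φ u b ∨ ∃ c, InL D φ x c ∧ Miss φ u c ∧ c ∉ F := by
  rcases h with h | h
  · exact Or.inl h
  · obtain ⟨c, hc, hcF⟩ := exists_notin (A := ms D φ u ∩ ms D φ x) (F := F) (by omega)
    rw [mem_inter, mem_ms, mem_ms] at hc
    exact Or.inr ⟨c, hc.2, hc.1.2.2, hcF⟩

lemma Conf.slot {b l n : ℕ} {I : Finset ℕ} {t z w : ℕ → V} (hI : Conf D φ x y b l I t z w n)
    {a : ℕ} (ha : a ∈ I) (F : Finset ℕ) (hF : F.card < n) (hbF : b ∉ F) :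
    Slot D φ x y b F (z a) := by
  obtain ⟨h0, h1, h2, h3, h4, h5, h6⟩ := hI a ha
  refine Or.inr (Or.inr ?_)
  rcases h6.weak F hF with h | ⟨c, h7, h8, h9⟩
  · exact ⟨t a, b, by rw [h1]; exact h0, by rw [h1, h2], h, hbF, Or.inl rfl⟩
  · exact ⟨t a, c, by rw [h1]; exact h0, by rw [h1, h2], h8, h9, Or.inr h7⟩

lemma Conf.mono {b l n : ℕ} {I I' : Finset ℕ} {t z w : ℕ → V} (hI : Conf D φ x y b l I t z w n)
    (h : I' ⊆ I) : Conf D φ x y b l I' t z w n := fun a ha => hI a (h ha)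

lemma Conf.winj (h : Col G D x y φ) {b l n : ℕ} {I : Finset ℕ} {t z w : ℕ → V}
    (hI : Conf D φ x y b l I t z w n) (hl : l ≠ 0) {a a' : ℕ} (ha : a ∈ I) (ha' : a' ∈ I)
    (e : w a = w a') : a = a' := by
  obtain ⟨h0, h1, h2, h3, h4, h5, h6⟩ := hI a ha
  obtain ⟨k0, k1, k2, k3, k4, k5, k6⟩ := hI a' ha'
  have : z a = z a' := by
    apply h.inj (w a)
    · rw [h.symm, h3]; exact hl
    · rw [h.symm, h3, e, h.symm, k3]
  rw [← h2, ← k2, this]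

lemma Conf.tinj {b l n : ℕ} {I : Finset ℕ} {t z w : ℕ → V}
    (hI : Conf D φ x y b l I t z w n) {a a' : ℕ} (ha : a ∈ I) (ha' : a' ∈ I)
    (e : t a = t a') : a = a' := by
  rw [← (hI a ha).2.1, ← (hI a' ha').2.1, e]

section
variable [Fintype V]

lemma Col.coreLL (h : Col G D x y φ) (hno : NoCol G D) {b l n c d : ℕ} {I : Finset ℕ}
    {t z w : ℕ → V} (hb : InL D φ y b) (hI : Conf D φ x y b l I t z w n) (hn : 4 ≤ n)
    (hl0 : l ≠ 0) (hlb : l ≠ b) (hc : InL D φ x c) (hd : InL D φ x d) (hcd : c ≠ d)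
    (hm : ∀ a ∈ I, Miss φ (w a) c ∧ Miss φ (w a) d) : I.card ≤ 1 := by
  by_contra hI1
  push Not at hI1
  obtain ⟨a, ha, a', ha', hne⟩ := one_lt_card.1 hI1
  obtain ⟨h0, h1, h2, h3, h4, h5, h6⟩ := hI a ha
  obtain ⟨k0, k1, k2, k3, k4, k5, k6⟩ := hI a' ha'
  have hcb := h.ne_beta hno hb hc
  have hdb := h.ne_beta hno hb hd
  have hF : ({l, c, d} : Finset ℕ).card < n := lt_of_le_of_lt card_le_three (by omega)
  have hbF : b ∉ ({l, c, d} : Finset ℕ) := by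
    simp only [mem_insert, mem_singleton, not_or]
    exact ⟨hlb.symm, hcb.symm, hdb.symm⟩
  refine h.conflict hno (F := {l, c, d}) hb (hI.slot ha _ hF hbF) (hI.slot ha' _ hF hbF) ?_
    (by simp) (by simp) (by simp) hl0 hlb h3 k3 h4 k4 h5 k5 hc hd hcd (hm a ha).1 (hm a' ha').1
    (hm a ha).2 (hm a' ha').2
  intro e
  apply hne
  rw [← h2, ← k2, e]

lemma able_sw {S : Set V} {a e b n : ℕ} {u : V} (hx : x ∉ S)
    (ha : ¬ InL D φ x a) (h : n + 1 ≤ (ms D φ u ∩ ms D φ x).card) :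
    Able D (sw φ S a e) x b n u := by
  refine Or.inr ?_
  have : (ms D φ u ∩ ms D φ x).erase e ⊆ ms D (sw φ S a e) u ∩ ms D (sw φ S a e) x := by
    intro c hc
    rw [mem_erase, mem_inter, mem_ms, mem_ms] at hc
    rw [mem_inter, mem_ms, mem_ms]
    have hca : c ≠ a := by rintro rfl; exact ha hc.2.2
    exact ⟨hc.2.1.sw_other hca hc.1, hc.2.2.sw_out hx⟩
  have h1 := card_le_card this
  have h2 := pred_card_le_card_erase (s := ms D φ u ∩ ms D φ x) (a := e)
  omega

lemma Col.convA (h : Col G D x y φ) (hno : NoCol G D) {b l n e d : ℕ} {I : Finset ℕ}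
    {t z w : ℕ → V} {t' : V} (hb : InL D φ y b) (hI : Conf D φ x y b l I t z w (n + 1))
    (hlb : l ≠ b) (ht' : φ y t' ≠ 0) (htI : φ y t' ∉ I)
    (he : InL D φ x e) (hte : Miss φ t' e) (hel : e ≠ l) (hed : e ≠ d) (hdb : d ≠ b)
    (hm : ∀ a ∈ I, Miss φ (w a) (φ y t') ∧ Miss φ (w a) d) :
    ∃ φ' : V → V → ℕ, ∃ I' ⊆ I, I.card ≤ I'.card + 1 ∧ Col G D x y φ' ∧
      (∀ v, φ' x v = φ x v) ∧ (∀ v, φ' y v = φ y v) ∧ Conf D φ' x y b l I' t z w n ∧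
      (∀ a ∈ I', Miss φ' (w a) (φ y t') ∧ Miss φ' (w a) d) ∧ Miss φ' t' b ∧
      ∀ t'' n', φ y t'' ≠ 0 → Able D φ x b (n' + 1) t'' →
        Able D φ' x b n' t'' ∨ Miss φ' t'' e := by
  classical
  have htx : t' ≠ x := by rintro rfl; exact ht' h.unc'
  have hty : t' ≠ y := by rintro rfl; exact ht' (h.self _)
  obtain ⟨hx, hy⟩ := h.notin hno hb he htx hty (Or.inl hte)
  have h1 := h.sw (h.comp_cl b e t') hb.1 he.1 hb.2.1 he.2.1
  have hbx : ¬ InL D φ x b := fun hbx => h.ne_beta hno hb hbx rfl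
  have htb : φ y t' ≠ b := hb.2.2 t'
  have hte' : φ y t' ≠ e := by rw [h.symm]; exact hte y
  set S := comp φ b e t' with hS
  refine ⟨Crit.sw φ S b e, I.filter (fun a => ¬ (t a ∈ S ∧ Miss φ (t a) b)), filter_subset _ _,
    ?_, h1, fun v => sw_out hx v, fun v => sw_out hy v, ?_, ?_, ?_, ?_⟩
  · have h2 := card_filter_add_card_filter_not (s := I) (fun a => t a ∈ S ∧ Miss φ (t a) b)
    have h3 : (I.filter (fun a => t a ∈ S ∧ Miss φ (t a) b)).card ≤ 1 := by
      by_contra h4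
      push Not at h4
      obtain ⟨a, ha, a', ha', hne⟩ := one_lt_card.1 h4
      rw [mem_filter] at ha ha'
      refine h.three hb.1 he.1 (mem_comp_self b e t') ha.2.1 ha'.2.1 ?_ ?_ ?_ (Or.inr hte)
        (Or.inl ha.2.2) (Or.inl ha'.2.2)
      · intro e1; apply htI; rw [e1, (hI a ha.1).2.1]; exact ha.1
      · intro e1; apply htI; rw [e1, (hI a' ha'.1).2.1]; exact ha'.1
      · intro e1; exact hne (hI.tinj ha.1 ha'.1 e1)
    omega
  · intro a ha
    rw [mem_filter] at ha
    obtain ⟨h0, h1, h2, h3, h4, h5, h6⟩ := hI a ha.1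
    refine ⟨h0, ?_, ?_, ?_, h4, h5, ?_⟩
    · rw [sw_out hy]; exact h1
    · rw [sw_out hx]; exact h2
    · rw [Crit.sw_other (by rw [h3]; exact hlb) (by rw [h3]; exact hel.symm)]; exact h3
    · rcases h6 with h6 | h6
      · left
        rw [miss_sw_out (fun hs => ha.2 ⟨hs, h6⟩)]; exact h6
      · exact able_sw hx hbx h6
  · intro a ha
    rw [mem_filter] at ha
    exact ⟨(miss_sw_other htb hte').2 (hm a ha.1).1, (miss_sw_other hdb hed.symm).2 (hm a ha.1).2⟩
  · exact (miss_sw_in_left (mem_comp_self b e t')).2 hte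
  · intro t'' n' _ h2
    rcases h2 with h2 | h2
    · by_cases hs : t'' ∈ S
      · right
        exact (miss_sw_in_right hs).2 h2
      · left; left
        exact (miss_sw_out hs).2 h2
    · left
      exact able_sw hx hbx h2

lemma Col.convB (h : Col G D x y φ) (hno : NoCol G D) {b l n c d : ℕ} {I : Finset ℕ}
    {t z w : ℕ → V} {t' : V} (hb : InL D φ y b) (hI : Conf D φ x y b l I t z w (n + 1))
    (hl0 : l ≠ 0) (hlt : l ≠ φ y t') (ht' : φ y t' ≠ 0) (htI : φ y t' ∉ I)
    (hc : InL D φ x c) (htb : Miss φ t' b) (hcl : c ≠ l) (hcd : c ≠ d) (hdt : d ≠ φ y t')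
    (hm : ∀ a ∈ I, Miss φ (w a) (φ y t') ∧ Miss φ (w a) d) :
    ∃ φ' : V → V → ℕ, ∃ I' ⊆ I, I.card ≤ I'.card + 2 ∧ Col G D x y φ' ∧
      (∀ v, φ' x v = φ x v) ∧ (∀ v, φ' y v = φ y v) ∧ Conf D φ' x y b l I' t z w n ∧
      (∀ a ∈ I', Miss φ' (w a) c ∧ Miss φ' (w a) d) ∧
      (∀ t'' n', t'' ≠ t' → φ y t'' ≠ 0 → Able D φ x b (n' + 1) t'' → Able D φ' x b n' t'') ∧
      ∀ t'' c', t'' ≠ t' → φ y t'' ≠ 0 → c' ≠ c → InL D φ x c' → Miss φ t'' c' →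
        Miss φ' t'' c' := by
  classical
  have htx : t' ≠ x := by rintro rfl; exact ht' h.unc'
  have hty : t' ≠ y := by rintro rfl; exact ht' (h.self _)
  have hαL : ¬ InL D φ x (φ y t') := fun hL => h.F1 hno hb hL rfl (Or.inl rfl) htb
  have hbα : b ≠ φ y t' := fun e => hb.2.2 t' e.symm
  have hcb := h.ne_beta hno hb hc
  have hcα : c ≠ φ y t' := by rintro rfl; exact hαL hc
  set α := φ y t' with hα
  have h2 := h.recolor ht' hb.1 hb.2.1 hb.2.2 htb
  have m2y : Miss (upd φ y t' b) y α := h.recolor_miss_y ht' hb.2.2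
  have m2t : Miss (upd φ y t' b) t' α := h.recolor_miss_t ht' htb
  set φ2 := upd φ y t' b with hφ2
  have r2x : ∀ v, φ2 x v = φ x v := upd_out _ _ h.ne htx.symm
  have hc2 : InL D φ2 x c := (InL_congr r2x).2 hc
  have hα2 : InL D φ2 y α := ⟨ht', h.le _ _, m2y⟩
  have hF3 : x ∈ comp φ2 α c y := h2.comp_symm (h2.F3 hno hα2 hc2)
  set S := (comp φ2 α c y ∪ comp φ2 α c t')ᶜ with hS
  have hyS : y ∉ S := by simp [hS, mem_comp_self]
  have htS : t' ∉ S := by simp [hS, mem_comp_self]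
  have hxS : x ∉ S := by simp [hS, hF3]
  have h3 := h2.sw (cl_compl (cl_union (h2.comp_cl α c y) (h2.comp_cl α c t'))) ht' hc.1
    (h.le _ _) hc.2.1
  rw [← hS] at h3
  set φ3 := Crit.sw φ2 S α c with hφ3
  have r3y : ∀ v, φ3 y v = φ2 y v := sw_out hyS
  have r3x : ∀ v, φ3 x v = φ2 x v := sw_out hxS
  have e3 : φ3 y t' = b := by rw [r3y, hφ2, upd_same]
  have h4 := h3.recolor (t := t') (c := α) (by rw [e3]; exact hb.1) ht' (h.le _ _)
    ((miss_sw_out hyS).2 m2y) ((miss_sw_out htS).2 m2t)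
  set φ4 := upd φ3 y t' α with hφ4
  have r4x : ∀ v, φ4 x v = φ x v := by
    intro v
    rw [hφ4, upd_out _ _ h.ne htx.symm, r3x, r2x]
  have r4y : ∀ v, φ4 y v = φ y v := by
    intro v
    by_cases e : v = t'
    · rw [e, hφ4, upd_same]
    · rw [hφ4, upd_ne _ _ (by tauto) (by tauto), r3y, hφ2, upd_ne _ _ (by tauto) (by tauto)]
  have r4 : ∀ u v, u ≠ y → u ≠ t' → φ u v ≠ α → φ u v ≠ c → φ4 u v = φ u v := by
    intro u v hu hut h5 h6
    have e : φ2 u v = φ u v := upd_out _ _ hu hut v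
    rw [hφ4, upd_out _ _ hu hut, hφ3, Crit.sw_other (by rw [e]; exact h5) (by rw [e]; exact h6), e]
  have m4 : ∀ u c', u ≠ y → u ≠ t' → c' ≠ α → c' ≠ c → (Miss φ4 u c' ↔ Miss φ u c') := by
    intro u c' hu hut h5 h6
    rw [hφ4, miss_upd_out _ _ hu hut, hφ3, miss_sw_other h5 h6, hφ2, miss_upd_out _ _ hu hut]
  have hable : ∀ t'' n', t'' ≠ t' → φ y t'' ≠ 0 → Able D φ x b (n' + 1) t'' →
      Able D φ4 x b n' t'' := by
    intro t'' n' hne h0 hA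
    have hty'' : t'' ≠ y := by rintro rfl; exact h0 (h.self _)
    rcases hA with hA | hA
    · left
      exact (m4 t'' b hty'' hne hbα hcb.symm).2 hA
    · right
      have : (ms D φ t'' ∩ ms D φ x).erase c ⊆ ms D φ4 t'' ∩ ms D φ4 x := by
        intro c' hc'
        rw [mem_erase, mem_inter, mem_ms, mem_ms] at hc'
        rw [mem_inter, mem_ms, mem_ms, InL_congr r4x]
        have hca : c' ≠ α := by rintro rfl; exact hαL hc'.2.2
        exact ⟨⟨hc'.2.1.1, hc'.2.1.2.1, (m4 t'' c' hty'' hne hca hc'.1).2 hc'.2.1.2.2⟩, hc'.2.2⟩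
      have h1 := card_le_card this
      have h2 := pred_card_le_card_erase (s := ms D φ t'' ∩ ms D φ x) (a := c)
      omega
  refine ⟨φ4, I.filter (fun a => w a ∉ comp φ2 α c t'), filter_subset _ _, ?_, h4, r4x, r4y,
    ?_, ?_, hable, ?_⟩
  · have h5 := card_filter_add_card_filter_not (s := I) (fun a => w a ∈ comp φ2 α c t')
    have h6 : (I.filter (fun a => w a ∈ comp φ2 α c t')).card ≤ 2 := by
      by_contra h7
      push Not at h7
      obtain ⟨a1, k1, a2, k2, a3, k3, k12, k13, k23⟩ := two_lt_card.1 h7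
      rw [mem_filter] at k1 k2 k3
      have mm : ∀ a ∈ I, Miss φ2 (w a) α := fun a ha => miss_upd hbα.symm (hm a ha).1
      exact h2.three ht' hc.1 k1.2 k2.2 k3.2
        (fun e => k12 (hI.winj h hl0 k1.1 k2.1 e)) (fun e => k13 (hI.winj h hl0 k1.1 k3.1 e))
        (fun e => k23 (hI.winj h hl0 k2.1 k3.1 e)) (Or.inl (mm _ k1.1)) (Or.inl (mm _ k2.1))
        (Or.inl (mm _ k3.1))
    omega
  · intro a ha
    rw [mem_filter] at ha
    obtain ⟨p0, p1, p2, p3, p4, p5, p6⟩ := hI a ha.1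
    have hwt : w a ≠ t' := by intro e; apply ha.2; rw [e]; exact mem_comp_self _ _ _
    have htt : t a ≠ t' := by
      intro e; apply htI; rw [hα, ← e, p1]; exact ha.1
    refine ⟨p0, by rw [r4y]; exact p1, by rw [r4x]; exact p2, ?_, p4, p5,
      hable _ _ htt (by rw [p1]; exact p0) p6⟩
    rw [h4.symm, r4 _ _ p5 hwt, h.symm, p3]
    · rw [h.symm, p3]; exact hlt
    · rw [h.symm, p3]; exact hcl.symm
  · intro a ha
    rw [mem_filter] at ha
    obtain ⟨p0, p1, p2, p3, p4, p5, p6⟩ := hI a ha.1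
    have hwt : w a ≠ t' := by intro e; apply ha.2; rw [e]; exact mem_comp_self _ _ _
    refine ⟨?_, (m4 _ _ p5 hwt hdt hcd.symm).2 (hm a ha.1).2⟩
    have mm : Miss φ2 (w a) α := miss_upd hbα.symm (hm a ha.1).1
    have hwS : w a ∈ S := by
      rw [hS, Set.mem_compl_iff, Set.mem_union, not_or]
      refine ⟨?_, ha.2⟩
      intro hwy
      exact h2.three ht' hc.1 (mem_comp_self α c y) hF3 hwy h.ne.symm p5.symm p4.symm
        (Or.inl m2y) (Or.inr hc2.2.2) (Or.inl mm)
    rw [hφ4, miss_upd_out _ _ p5 hwt, hφ3, miss_sw_in_right hwS]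
    exact mm
  · intro t'' c' hne h0 hcc hL hM
    have hty'' : t'' ≠ y := by rintro rfl; exact h0 (h.self _)
    have hca : c' ≠ α := by rintro rfl; exact hαL hL
    exact (m4 t'' c' hty'' hne hca hcc).2 hM

/-- one conversion -/
lemma Col.conv (h : Col G D x y φ) (hno : NoCol G D) {b l n d : ℕ} {I : Finset ℕ}
    {t z w : ℕ → V} {t' : V} (hb : InL D φ y b) (hI : Conf D φ x y b l I t z w (n + 2))
    (hl0 : l ≠ 0) (hlb : l ≠ b) (hlt : l ≠ φ y t') (ht' : φ y t' ≠ 0) (htI : φ y t' ∉ I)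
    (hL : 10 ≤ (ms D φ x).card) (hdb : d ≠ b) (hdt : d ≠ φ y t')
    (hw : Miss φ t' b ∨ ∃ c, InL D φ x c ∧ Miss φ t' c ∧ c ∉ ({l, d} : Finset ℕ))
    (hm : ∀ a ∈ I, Miss φ (w a) (φ y t') ∧ Miss φ (w a) d) :
    ∃ φ' : V → V → ℕ, ∃ I' ⊆ I, ∃ c, I.card ≤ I'.card + 3 ∧ Col G D x y φ' ∧
      (∀ v, φ' x v = φ x v) ∧ (∀ v, φ' y v = φ y v) ∧ Conf D φ' x y b l I' t z w n ∧
      InL D φ x c ∧ c ≠ l ∧ c ≠ d ∧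
      (∀ a ∈ I', Miss φ' (w a) c ∧ Miss φ' (w a) d) ∧
      (∀ t'', t'' ≠ t' → φ y t'' ≠ 0 → Able D φ x b 5 t'' →
        (Miss φ' t'' b ∨ ∃ c', InL D φ' x c' ∧ Miss φ' t'' c' ∧ c' ∉ ({l, c} : Finset ℕ))) := by
  have A1 : ∃ e, ∃ φ' : V → V → ℕ, ∃ I' ⊆ I, I.card ≤ I'.card + 1 ∧ Col G D x y φ' ∧
      (∀ v, φ' x v = φ x v) ∧ (∀ v, φ' y v = φ y v) ∧ Conf D φ' x y b l I' t z w (n + 1) ∧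
      (∀ a ∈ I', Miss φ' (w a) (φ y t') ∧ Miss φ' (w a) d) ∧ Miss φ' t' b ∧
      ∀ t'', φ y t'' ≠ 0 → Able D φ x b 5 t'' →
        Able D φ' x b 4 t'' ∨ (Miss φ' t'' e ∧ InL D φ x e ∧ e ≠ l) := by
    rcases hw with hw | ⟨e, he, hte, hel⟩
    · refine ⟨0, φ, I, Subset.refl _, by omega, h, fun _ => rfl, fun _ => rfl, ?_, hm, hw, ?_⟩
      · intro a ha
        obtain ⟨p0, p1, p2, p3, p4, p5, p6⟩ := hI a ha
        exact ⟨p0, p1, p2, p3, p4, p5, p6.imp id (fun hh => by omega)⟩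
      · intro t'' _ hA
        exact Or.inl (hA.imp id (fun hh => by omega))
    · simp only [mem_insert, mem_singleton, not_or] at hel
      obtain ⟨φ', I', q1, q2, q3, q4, q5, q6, q7, q8, q9⟩ :=
        h.convA hno hb hI hlb ht' htI he hte hel.1 hel.2 hdb hm
      exact ⟨e, φ', I', q1, q2, q3, q4, q5, q6, q7, q8, fun t'' h0 hA =>
        (q9 t'' 4 h0 hA).imp id (fun hh => ⟨hh, he, hel.1⟩)⟩
  obtain ⟨e, φ', I', q1, q2, q3, q4, q5, q6, q7, q8, q9⟩ := A1
  obtain ⟨c, hc, hcF⟩ := exists_notin (A := ms D φ x) (F := {l, d, e})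
    (lt_of_le_of_lt card_le_three (by omega))
  rw [mem_ms] at hc
  simp only [mem_insert, mem_singleton, not_or] at hcF
  obtain ⟨hcl, hcd, hce⟩ := hcF
  obtain ⟨φ'', I'', s1, s2, s3, s4, s5, s6, s7, s8, s9⟩ :=
    q3.convB hno (c := c) (d := d) (t' := t') ((InL_congr q5).2 hb) q6 hl0 (by rw [q5]; exact hlt)
      (by rw [q5]; exact ht') (by rw [q5]; exact fun hh => htI (q1 hh)) ((InL_congr q4).2 hc) q8
      hcl hcd (by rw [q5]; exact hdt) (by rw [q5]; exact q7)
  refine ⟨φ'', I'', s1.trans q1, c, by omega, s3, fun v => by rw [s4, q4],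
    fun v => by rw [s5, q5], s6, hc, hcl, hcd, s7, ?_⟩
  intro t'' hne h0 hA
  rcases q9 t'' h0 hA with hA | ⟨hA1, hA2, hA3⟩
  · have := s8 t'' 3 hne (by rw [q5]; exact h0) hA
    exact this.weak {l, c} (lt_of_le_of_lt card_le_two (by omega))
  · right
    have he' : InL D φ' x e := (InL_congr q4).2 hA2
    refine ⟨e, (InL_congr s4).2 he', s9 t'' e hne (by rw [q5]; exact h0) (fun e1 => hce e1.symm) he' hA1, ?_⟩
    simp only [mem_insert, mem_singleton, not_or]
    exact ⟨hA3, fun e1 => hce e1.symm⟩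

lemma Col.coreLA (h : Col G D x y φ) (hno : NoCol G D) {b l n d : ℕ} {I : Finset ℕ}
    {t z w : ℕ → V} {t' : V} (hb : InL D φ y b) (hI : Conf D φ x y b l I t z w (n + 2))
    (hn : 4 ≤ n) (hl0 : l ≠ 0) (hlb : l ≠ b) (ht' : φ y t' ≠ 0)
    (hL : 10 ≤ (ms D φ x).card) (hd : InL D φ x d) (hdt : d ≠ φ y t')
    (hw : Miss φ t' b ∨ ∃ c, InL D φ x c ∧ Miss φ t' c ∧ c ∉ ({l, d} : Finset ℕ))
    (hm : ∀ a ∈ I, Miss φ (w a) (φ y t') ∧ Miss φ (w a) d) : I.card ≤ 5 := by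
  classical
  by_contra hcon
  push Not at hcon
  obtain ⟨a, ha⟩ := card_pos.1 (show 0 < I.card by omega)
  have hlt : l ≠ φ y t' := by
    intro e
    apply (hm a ha).1 (z a)
    rw [h.symm, (hI a ha).2.2.2.1, e]
  obtain ⟨φ', I', q1, c, q2, q3, q4, q5, q6, q7, q8, q9, q10, -⟩ :=
    h.conv hno hb (hI.mono (erase_subset (φ y t') I)) hl0 hlb hlt ht' (notMem_erase _ _) hL
      (h.ne_beta hno hb hd) hdt hw (fun a ha => hm a (mem_of_mem_erase ha))
  have h1 := q3.coreLL hno ((InL_congr q5).2 hb) q6 hn hl0 hlb ((InL_congr q4).2 q7)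
    ((InL_congr q4).2 hd) q9 q10
  have h2 := pred_card_le_card_erase (s := I) (a := φ y t')
  omega

lemma Col.coreAA (h : Col G D x y φ) (hno : NoCol G D) {b l n : ℕ} {I : Finset ℕ}
    {t z w : ℕ → V} {t₁ t₂ : V} (hb : InL D φ y b) (hI : Conf D φ x y b l I t z w (n + 4))
    (hn : 4 ≤ n) (hl0 : l ≠ 0) (hlb : l ≠ b) (ht₁ : φ y t₁ ≠ 0) (ht₂ : φ y t₂ ≠ 0)
    (hne : φ y t₁ ≠ φ y t₂) (hL : 10 ≤ (ms D φ x).card) (hA₁ : Able D φ x b 5 t₁)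
    (hA₂ : Able D φ x b 5 t₂)
    (hm : ∀ a ∈ I, Miss φ (w a) (φ y t₁) ∧ Miss φ (w a) (φ y t₂)) : I.card ≤ 9 := by
  classical
  by_contra hcon
  push Not at hcon
  obtain ⟨a, ha⟩ := card_pos.1 (show 0 < I.card by omega)
  have hlt : l ≠ φ y t₁ := by
    intro e
    apply (hm a ha).1 (z a)
    rw [h.symm, (hI a ha).2.2.2.1, e]
  obtain ⟨φ', I', q1, c, q2, q3, q4, q5, q6, q7, q8, q9, q10, q11⟩ :=
    h.conv hno (n := n + 2) hb (hI.mono (erase_subset (φ y t₁) I)) hl0 hlb hlt ht₁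
      (notMem_erase _ _) hL (hb.2.2 t₂) hne.symm
      (hA₁.weak _ (lt_of_le_of_lt card_le_two (by omega))) (fun a ha => hm a (mem_of_mem_erase ha))
  have hw := q11 t₂ (by rintro rfl; exact hne rfl) ht₂ hA₂
  have h1 := q3.coreLA hno (d := c) (t' := t₂) ((InL_congr q5).2 hb) q6 hn hl0 hlb
    (by rw [q5]; exact ht₂) (by rw [ms_congr q4]; exact hL) ((InL_congr q4).2 q7)
    (by rw [q5]; exact q9) hw (by rw [q5]; exact fun a ha => (q10 a ha).symm)
  have h2 := pred_card_le_card_erase (s := I) (a := φ y t₁)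
  omega

/-- Lemma M, local form -/
lemma Col.lemM0 (h : Col G D x y φ) (hno : NoCol G D) {b l : ℕ} {I A : Finset ℕ}
    {t z w : ℕ → V} (hb : InL D φ y b) (hI : Conf D φ x y b l I t z w 10)
    (hl0 : l ≠ 0) (hlb : l ≠ b) (hA : ∀ a ∈ A, a ≠ 0 ∧ φ y (t a) = a ∧ Able D φ x b 5 (t a))
    (hL : 10 ≤ (ms D φ x).card) {d₁ d₂ : ℕ} (h1 : d₁ ∈ ms D φ x ∪ A) (h2 : d₂ ∈ ms D φ x ∪ A)
    (hne : d₁ ≠ d₂) (hm : ∀ a ∈ I, Miss φ (w a) d₁ ∧ Miss φ (w a) d₂) : I.card ≤ 9 := by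
  rw [mem_union, mem_ms] at h1 h2
  rcases h1 with h1 | h1 <;> rcases h2 with h2 | h2
  · have := h.coreLL hno hb hI (by omega) hl0 hlb h1 h2 hne hm
    omega
  · obtain ⟨p1, p2, p3⟩ := hA d₂ h2
    have := h.coreLA hno (n := 8) (d := d₁) (t' := t d₂) hb hI (by omega) hl0 hlb
      (by rw [p2]; exact p1) hL h1 (by rw [p2]; exact hne)
      (p3.weak _ (lt_of_le_of_lt card_le_two (by omega))) (by rw [p2]; exact fun a ha => (hm a ha).symm)
    omega
  · obtain ⟨p1, p2, p3⟩ := hA d₁ h1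
    have := h.coreLA hno (n := 8) (d := d₂) (t' := t d₁) hb hI (by omega) hl0 hlb
      (by rw [p2]; exact p1) hL h2 (by rw [p2]; exact hne.symm)
      (p3.weak _ (lt_of_le_of_lt card_le_two (by omega))) (by rw [p2]; exact hm)
    omega
  · obtain ⟨p1, p2, p3⟩ := hA d₁ h1
    obtain ⟨r1, r2, r3⟩ := hA d₂ h2
    exact h.coreAA hno (n := 6) (t₁ := t d₁) (t₂ := t d₂) hb hI (by omega) hl0 hlb
      (by rw [p2]; exact p1) (by rw [r2]; exact r1) (by rw [p2, r2]; exact hne) hL p3 r3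
      (by rw [p2, r2]; exact hm)

end

section
variable [Fintype V]

lemma Col.lemM1 (h : Col G D x y φ) (hno : NoCol G D) {b l : ℕ} {I A : Finset ℕ}
    {t z w : ℕ → V} (hb : InL D φ y b) (hI : Conf D φ x y b l I t z w 10)
    (hD : 5 ^ 25 ≤ D)
    (hl0 : l ≠ 0) (hlb : l ≠ b) (hA : ∀ a ∈ A, a ≠ 0 ∧ φ y (t a) = a ∧ Able D φ x b 5 (t a))
    (hL : 10 ≤ (ms D φ x).card)
    (hw : ∀ a ∈ I, D ≤ 200 * (ms D φ (w a) ∩ (ms D φ x ∪ A)).card) : I.card ≤ 450000 := by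
  classical
  set B := ms D φ x ∪ A with hB
  have hBc : B.card ≤ D := by
    have : B ⊆ Finset.Icc 1 D := by
      apply union_subset (ms_sub _ _ _)
      intro a ha
      obtain ⟨h1, h2, h3⟩ := hA a ha
      rw [mem_Icc]
      refine ⟨Nat.pos_of_ne_zero h1, ?_⟩
      rw [← h2]; exact h.le _ _
    have := card_le_card this
    simpa using this
  have hdc := sum_card_bipartiteAbove_eq_sum_card_bipartiteBelow (s := I) (t := B.offDiag)
    (fun a p => Miss φ (w a) p.1 ∧ Miss φ (w a) p.2)
  have hub : ∑ p ∈ B.offDiag,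
      (bipartiteBelow (fun (a : ℕ) (p : ℕ × ℕ) => Miss φ (w a) p.1 ∧ Miss φ (w a) p.2) I p).card
      ≤ ∑ p ∈ B.offDiag, 9 := by
    apply sum_le_sum
    intro p hp
    rw [mem_offDiag] at hp
    refine h.lemM0 hno hb (hI.mono (filter_subset _ _)) hl0 hlb hA hL hp.1 hp.2.1 hp.2.2 ?_
    intro a ha
    exact (mem_filter.1 ha).2
  have hlb : ∑ a ∈ I, ((D / 200) * (D / 200) - (D / 200)) ≤ ∑ a ∈ I,
      (bipartiteAbove (fun (a : ℕ) (p : ℕ × ℕ) => Miss φ (w a) p.1 ∧ Miss φ (w a) p.2)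
        B.offDiag a).card := by
    apply sum_le_sum
    intro a ha
    have h1 : (ms D φ (w a) ∩ B).offDiag ⊆
        bipartiteAbove (fun (a : ℕ) (p : ℕ × ℕ) => Miss φ (w a) p.1 ∧ Miss φ (w a) p.2)
        B.offDiag a := by
      intro p hp
      rw [mem_offDiag, mem_inter, mem_inter, mem_ms, mem_ms] at hp
      rw [mem_bipartiteAbove, mem_offDiag]
      exact ⟨⟨hp.1.2, hp.2.1.2, hp.2.2⟩, hp.1.1.2.2, hp.2.1.1.2.2⟩
    have h2 := card_le_card h1
    rw [offDiag_card] at h2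
    refine le_trans ?_ h2
    have h3 := hw a ha
    set s := (ms D φ (w a) ∩ B).card
    have h4 : D / 200 ≤ s := by omega
    have h5 : ∀ m : ℕ, m * m - m = m * (m - 1) := fun m => by
      rw [Nat.mul_sub, mul_one]
    rw [h5, h5]
    exact Nat.mul_le_mul h4 (by omega)
  rw [hdc] at hlb
  have h3 := hlb.trans hub
  rw [sum_const, sum_const, offDiag_card, smul_eq_mul, smul_eq_mul] at h3
  have h4 : B.card * B.card - B.card ≤ D * D := by
    refine (Nat.sub_le _ _).trans (Nat.mul_le_mul hBc hBc)
  set q := D / 200 with hq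
  have h5 : D < 200 * (q + 1) := by omega
  have h6 : 10 ^ 15 ≤ q := by norm_num at hD ⊢; omega
  by_contra hcon
  push Not at hcon
  have h7 : 450001 * (q * q - q) ≤ I.card * (q * q - q) := Nat.mul_le_mul_right _ hcon
  have h8 : q ≤ q * q := Nat.le_mul_self q
  have h9 : 450001 * (q * q - q) ≤ D * D * 9 := by
    refine h7.trans (h3.trans (Nat.mul_le_mul_right _ h4))
  have h10 : D * D * 9 ≤ (200 * (q + 1)) * (200 * (q + 1)) * 9 := by
    gcongr
  obtain ⟨r, hr⟩ := Nat.exists_eq_add_of_le h8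
  rw [hr, Nat.add_sub_cancel_left] at h9
  nlinarith

variable [DecidableRel G.Adj]

/-- Lemma M, summed -/
lemma Col.lemM2 (h : Col G D x y φ) (hno : NoCol G D) {b : ℕ} {A Q : Finset ℕ}
    {t z : ℕ → V} (hb : InL D φ y b) (hD : 5 ^ 25 ≤ D) {X : Finset V} (hyX : y ∉ X)
    (hA : ∀ a ∈ A, a ≠ 0 ∧ φ y (t a) = a ∧ Able D φ x b 10 (t a))
    (hz : ∀ a ∈ A, φ x (z a) = a)
    (hL : 10 ≤ (ms D φ x).card)
    (hw : ∀ w ∈ X, w ≠ x → 100 * G.degree w ≤ 67 * D →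
      D ≤ 200 * (ms D φ w ∩ (ms D φ x ∪ A)).card)
    (hQ : ∀ a ∈ A, ∀ w ∈ lowN G X D (z a), w ≠ x → φ (z a) w ≠ b → φ (z a) w ∈ Q) :
    ∑ a ∈ A, (lowN G X D (z a)).card ≤ 2 * A.card + 450000 * Q.card := by
  classical
  have : Nonempty V := ⟨x⟩
  have hne : ∀ a ∈ A, ∀ w ∈ lowN G X D (z a), w ≠ x → φ (z a) w ≠ 0 ∧ w ≠ y ∧ w ∈ X ∧
      100 * G.degree w ≤ 67 * D := by
    intro a ha w hw hwx
    rw [mem_lowN] at hw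
    have hwy : w ≠ y := by rintro rfl; exact hyX hw.1
    refine ⟨?_, hwy, hw.1, hw.2.2⟩
    intro h0
    rcases h.col _ _ hw.2.1 h0 with ⟨_, e⟩ | ⟨_, e⟩
    · exact hwy e
    · exact hwx e
  -- per colour
  have hcol : ∀ l ∈ Q.filter (fun l => l ≠ b ∧ l ≠ 0),
      (A.filter (fun a => ∃ w ∈ lowN G X D (z a), w ≠ x ∧ φ (z a) w = l)).card ≤ 450000 := by
    intro l hl
    rw [mem_filter] at hl
    have hex : ∀ a ∈ A.filter (fun a => ∃ w ∈ lowN G X D (z a), w ≠ x ∧ φ (z a) w = l),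
        ∃ w, w ∈ lowN G X D (z a) ∧ w ≠ x ∧ φ (z a) w = l := by
      intro a ha
      obtain ⟨_, w, h1, h2⟩ := mem_filter.1 ha
      exact ⟨w, h1, h2⟩
    choose! w hw1 using hex
    refine h.lemM1 hno (l := l) (t := t) (z := z) (w := w) (A := A) hb ?_ hD hl.2.2 hl.2.1 ?_ hL ?_
    · intro a ha
      obtain ⟨h1, h2, h3⟩ := hw1 a ha
      have haA := (mem_filter.1 ha).1
      obtain ⟨k1, k2, k3⟩ := hA a haA
      exact ⟨k1, k2, hz a haA, h3, h2, (hne a haA _ h1 h2).2.1, k3⟩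
    · intro a ha
      obtain ⟨k1, k2, k3⟩ := hA a ha
      exact ⟨k1, k2, k3.imp id (fun hh => by omega)⟩
    · intro a ha
      obtain ⟨h1, h2, h3⟩ := hw1 a ha
      obtain ⟨_, _, k1, k2⟩ := hne a (mem_filter.1 ha).1 _ h1 h2
      exact hw _ k1 h2 k2
  -- counting
  have e1 : ∀ a ∈ A, (lowN G X D (z a)).card ≤ 2 + ((Q.filter (fun l => l ≠ b ∧ l ≠ 0)).filter
      (fun l => ∃ w ∈ lowN G X D (z a), w ≠ x ∧ φ (z a) w = l)).card := by
    intro a ha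
    have e2 : ((lowN G X D (z a)).erase x).image (φ (z a)) ⊆
        insert b ((Q.filter (fun l => l ≠ b ∧ l ≠ 0)).filter
          (fun l => ∃ w ∈ lowN G X D (z a), w ≠ x ∧ φ (z a) w = l)) := by
      intro l hl
      obtain ⟨w, hw, rfl⟩ := mem_image.1 hl
      rw [mem_erase] at hw
      rw [mem_insert]
      by_cases e : φ (z a) w = b
      · exact Or.inl e
      · right
        rw [mem_filter, mem_filter]
        exact ⟨⟨hQ a ha w hw.2 hw.1 e, e, (hne a ha w hw.2 hw.1).1⟩, w, hw.2, hw.1, rfl⟩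
    have e3 := card_le_card e2
    rw [card_image_of_injOn] at e3
    · have e4 := pred_card_le_card_erase (s := lowN G X D (z a)) (a := x)
      have e5 := card_insert_le b ((Q.filter (fun l => l ≠ b ∧ l ≠ 0)).filter
          (fun l => ∃ w ∈ lowN G X D (z a), w ≠ x ∧ φ (z a) w = l))
      omega
    · intro w hw w' hw' e
      rw [mem_coe, mem_erase] at hw
      exact h.inj _ _ _ (hne a ha w hw.2 hw.1).1 e
  have e2 := sum_le_sum e1
  rw [sum_add_distrib, sum_const, smul_eq_mul] at e2
  have hdc := sum_card_bipartiteAbove_eq_sum_card_bipartiteBelow (s := A)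
    (t := Q.filter (fun l => l ≠ b ∧ l ≠ 0))
    (fun a l => ∃ w ∈ lowN G X D (z a), w ≠ x ∧ φ (z a) w = l)
  simp only [bipartiteAbove, bipartiteBelow] at hdc
  rw [hdc] at e2
  have e3 := sum_le_sum hcol
  rw [sum_const, smul_eq_mul] at e3
  have e4 := card_filter_le Q (fun l => l ≠ b ∧ l ≠ 0)
  omega

/-- consequence for `x` of degree at most `.325 D` -/
lemma Col.lemM3 (h : Col G D x y φ) (hno : NoCol G D) (hdeg : ∀ v, G.degree v ≤ D)
    (hD : 5 ^ 25 ≤ D) {X : Finset V} (hX : ∀ u ∈ X, ∀ v ∈ X, u ≠ v → ¬ G.Adj u v) (hx : x ∈ X)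
    (hk : 1000 * G.degree x ≤ 325 * D) :
    ∃ Z ⊆ G.neighborFinset x, Z.card + 1 = (lowN G X D y).card ∧
      ∑ z ∈ Z, (lowN G X D z).card ≤ 2 * Z.card + 450000 * G.degree x := by
  classical
  obtain ⟨b, hb⟩ := h.exists_beta hdeg
  have : Nonempty V := ⟨x⟩
  have hyX : y ∉ X := fun hy => hX x hx y hy h.ne h.xy
  have hmx := h.card_ms_x
  norm_num at hD
  have hcom : ∀ t, t ≠ x → t ≠ y → 100 * G.degree t ≤ 67 * D →
      D ≤ 200 * (ms D φ t ∩ ms D φ x).card := by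
    intro t h1 h2 h3
    have h4 := h.card_ms_other h1 h2
    have h5 := card_inter (n := 330 * D / 1000 + 1 - 325 * D / 1000) (ms_sub D φ t) (ms_sub D φ x) (by omega)
    omega
  set T := (lowN G X D y).erase x with hT
  have hTm : ∀ t ∈ T, t ≠ x ∧ t ≠ y ∧ φ y t ≠ 0 ∧ 100 * G.degree t ≤ 67 * D := by
    intro t ht
    rw [hT, mem_erase, mem_lowN] at ht
    have hty : t ≠ y := by rintro rfl; exact hyX ht.2.1
    refine ⟨ht.1, hty, ?_, ht.2.2.2⟩
    intro h0
    rcases h.col y t ht.2.2.1 h0 with ⟨e, _⟩ | ⟨_, e⟩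
    · exact h.ne e.symm
    · exact ht.1 e
  have hxl : x ∈ lowN G X D y := by
    rw [mem_lowN]
    refine ⟨hx, h.xy.symm, ?_⟩
    omega
  have hTc : T.card + 1 = (lowN G X D y).card := card_erase_add_one hxl
  set A := T.image (φ y) with hA
  have hAc : A.card = T.card := by
    rw [hA, card_image_of_injOn]
    intro t ht t' ht' e
    exact h.inj y t t' (hTm t ht).2.2.1 e
  have hAt : ∀ a ∈ A, ∃ t ∈ T, φ y t = a := fun a ha => mem_image.1 ha
  choose! tf htf1 htf2 using hAt
  have hab : ∀ a ∈ A, 10 ≤ (ms D φ (tf a) ∩ ms D φ x).card := by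
    intro a ha
    obtain ⟨h1, h2, h3, h4⟩ := hTm _ (htf1 a ha)
    have := hcom _ h1 h2 h4
    omega
  have hA0 : ∀ a ∈ A, a ≠ 0 := fun a ha => by
    rw [← htf2 a ha]; exact (hTm _ (htf1 a ha)).2.2.1
  have hAK : ∀ a ∈ A, ∃ z, φ x z = a := by
    intro a ha
    by_contra hn
    push Not at hn
    have h5 := hab a ha
    obtain ⟨c, hc⟩ := card_pos.1 (show 0 < (ms D φ (tf a) ∩ ms D φ x).card by omega)
    rw [mem_inter, mem_ms, mem_ms] at hc
    refine h.F1 hno hb ⟨hA0 a ha, ?_, hn⟩ (htf2 a ha) (Or.inr hc.2) hc.1.2.2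
    rw [← htf2 a ha]; exact h.le _ _
  choose! zf hzf using hAK
  have hzinj : ∀ a ∈ A, ∀ a' ∈ A, zf a = zf a' → a = a' := by
    intro a ha a' ha' e
    rw [← hzf a ha, ← hzf a' ha', e]
  have key := h.lemM2 hno (A := A) (Q := (Finset.Icc 1 D) \ ms D φ x) (t := tf) (z := zf) hb
    (by norm_num; omega) hyX
    (fun a ha => ⟨hA0 a ha, htf2 a ha, Or.inr (hab a ha)⟩) hzf (by omega)
    (by
      intro w hw hwx hwd
      have h1 := hcom w hwx (by rintro rfl; exact hyX hw) hwd
      have h2 : (ms D φ w ∩ ms D φ x).card ≤ (ms D φ w ∩ (ms D φ x ∪ A)).card :=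
        card_le_card (inter_subset_inter_left subset_union_left)
      omega)
    (by
      intro a ha w hw hwx hwb
      rw [mem_lowN] at hw
      have hwy : w ≠ y := by rintro rfl; exact hyX hw.1
      rw [mem_sdiff, mem_Icc]
      have h0 : φ (zf a) w ≠ 0 := by
        intro h0
        rcases h.col _ _ hw.2.1 h0 with ⟨_, e⟩ | ⟨_, e⟩
        · exact hwy e
        · exact hwx e
      refine ⟨⟨Nat.pos_of_ne_zero h0, h.le _ _⟩, ?_⟩
      intro hL
      have h1 := hcom w hwx hwy hw.2.2
      obtain ⟨d, hd⟩ := card_pos.1 (show 0 < (ms D φ w ∩ ms D φ x).card by omega)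
      rw [mem_inter, mem_ms, mem_ms] at hd
      obtain ⟨c, hc, hcF⟩ := exists_notin (A := ms D φ (tf a) ∩ ms D φ x) (F := {φ (zf a) w, d})
        (lt_of_le_of_lt card_le_two (by have := hab a ha; omega))
      simp only [mem_inter, mem_ms, mem_insert, mem_singleton, not_or] at hc hcF
      exact h.R hno hb (t := tf a) (z := zf a) (by rw [htf2 a ha]; exact hA0 a ha)
        (by rw [hzf a ha, htf2 a ha]) hc.1.2.2 (Or.inr hc.2) (mem_ms.1 hL) rfl hwx hwy hd.2
        hd.1.2.2 hcF.1 hcF.2)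
  refine ⟨A.image zf, ?_, ?_, ?_⟩
  · intro z hz
    obtain ⟨a, ha, rfl⟩ := mem_image.1 hz
    rw [SimpleGraph.mem_neighborFinset]
    apply h.adj
    rw [hzf a ha]; exact hA0 a ha
  · rw [card_image_of_injOn, hAc, hTc]
    intro a ha a' ha' e
    exact hzinj a ha a' ha' e
  · rw [sum_image (fun a ha a' ha' e => hzinj a ha a' ha' e), card_image_of_injOn
      (fun a ha a' ha' e => hzinj a ha a' ha' e)]
    have e5 := card_sdiff_add_card_eq_card (ms_sub D φ x)
    rw [Nat.card_Icc] at e5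
    have : ((Finset.Icc 1 D) \ ms D φ x).card ≤ G.degree x := by omega
    refine key.trans ?_
    omega

end

section
variable [Fintype V] [DecidableRel G.Adj]

/-- averaging choice of a second colour -/
lemma Col.lemM4 (h : Col G D x y φ) (hno : NoCol G D) (hdeg : ∀ v, G.degree v ≤ D)
    (hD : 5 ^ 25 ≤ D) {X : Finset V} (hX : ∀ u ∈ X, ∀ v ∈ X, u ≠ v → ¬ G.Adj u v) (hx : x ∈ X)
    (hk1 : 325 * D < 1000 * G.degree x) (hk2 : 100 * G.degree x ≤ 67 * D)
    (hbig : (10000 * G.degree x + 20000) * G.degree x + 3 * 3250 * D ≤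
      (lowN G X D y).card * 3250 * D + 3249 * D * G.degree x) :
    ∃ Z ⊆ G.neighborFinset x, 10000 * G.degree x ≤ 10000 * Z.card + 3249 * D ∧
      ∑ z ∈ Z, (lowN G X D z).card ≤ 2 * Z.card + 450000 * D := by
  classical
  obtain ⟨b, hb⟩ := h.exists_beta hdeg
  have : Nonempty V := ⟨x⟩
  have hyX : y ∉ X := fun hy => hX x hx y hy h.ne h.xy
  have hmx := h.card_ms_x
  norm_num at hD
  set k := G.degree x with hkdef
  set T := (lowN G X D y).erase x with hT
  have hTm : ∀ t ∈ T, t ≠ x ∧ t ≠ y ∧ φ y t ≠ 0 ∧ 100 * G.degree t ≤ 67 * D := by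
    intro t ht
    rw [hT, mem_erase, mem_lowN] at ht
    have hty : t ≠ y := by rintro rfl; exact hyX ht.2.1
    refine ⟨ht.1, hty, ?_, ht.2.2.2⟩
    intro h0
    rcases h.col y t ht.2.2.1 h0 with ⟨e, _⟩ | ⟨_, e⟩
    · exact h.ne e.symm
    · exact ht.1 e
  have hxl : x ∈ lowN G X D y := by
    rw [mem_lowN]
    exact ⟨hx, h.xy.symm, hk2⟩
  have hTc : T.card + 1 = (lowN G X D y).card := card_erase_add_one hxl
  set K := (Finset.Icc 1 D) \ ms D φ x with hK
  have hKc : K.card + (ms D φ x).card = D := by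
    have e5 := card_sdiff_add_card_eq_card (ms_sub D φ x)
    rw [Nat.card_Icc, ← hK] at e5
    omega
  set TL := T.filter (fun t => 10 ≤ (ms D φ t ∩ ms D φ x).card) with hTL
  set T' := T.filter (fun t => ¬ 10 ≤ (ms D φ t ∩ ms D φ x).card) with hT'
  have hTT : TL.card + T'.card = T.card := card_filter_add_card_filter_not _
  have hdc := sum_card_bipartiteAbove_eq_sum_card_bipartiteBelow (s := T') (t := K)
    (fun t c => Miss φ t c)
  simp only [bipartiteAbove, bipartiteBelow] at hdc
  have hrow : ∀ t ∈ T', 33 * D ≤ 100 * (K.filter (fun c => Miss φ t c)).card + 900 := by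
    intro t ht
    obtain ⟨h1, h2⟩ := mem_filter.1 ht
    obtain ⟨h3, h4, _, h5⟩ := hTm t h1
    have h6 := h.card_ms_other h3 h4
    have h7 : ms D φ t ⊆ (K.filter (fun c => Miss φ t c)) ∪ (ms D φ t ∩ ms D φ x) := by
      intro c hc
      by_cases hcx : c ∈ ms D φ x
      · exact mem_union_right _ (mem_inter.2 ⟨hc, hcx⟩)
      · refine mem_union_left _ (mem_filter.2 ⟨mem_sdiff.2 ⟨ms_sub _ _ _ hc, hcx⟩, ?_⟩)
        exact (mem_ms.1 hc).2.2
    have h8 := (card_le_card h7).trans (card_union_le _ _)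
    omega
  obtain ⟨q, hqK, hq⟩ : ∃ q ∈ K, T'.card * (33 * D - 900) ≤
      100 * (T'.filter (fun t => Miss φ t q)).card * k := by
    by_contra hn
    push Not at hn
    have hne : K.Nonempty := card_pos.1 (by omega)
    have h1 := sum_lt_sum_of_nonempty hne hn
    rw [sum_const, smul_eq_mul, ← sum_mul, ← mul_sum, ← hdc] at h1
    have h2 : T'.card * (33 * D - 900) ≤ 100 * ∑ t ∈ T', (K.filter (fun c => Miss φ t c)).card := by
      rw [mul_sum]
      rw [← smul_eq_mul]
      apply card_nsmul_le_sum
      intro t ht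
      have := hrow t ht
      omega
    have h3 := Nat.mul_le_mul_right k h2
    have h4 : K.card ≤ k := by omega
    have h5 := Nat.mul_le_mul_right (T'.card * (33 * D - 900)) h4
    rw [mul_comm _ k] at h3
    omega
  have hqD : q ≠ 0 ∧ q ≤ D ∧ ¬ InL D φ x q := by
    rw [hK, mem_sdiff, mem_Icc, mem_ms] at hqK
    exact ⟨by omega, hqK.1.2, hqK.2⟩
  obtain ⟨hq0, hqD, hqx⟩ := hqD
  set S := comp φ b q y with hS
  have hcl : Cl φ S b q := h.comp_cl b q y
  have h' := h.sw hcl hb.1 hq0 hb.2.1 hqD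
  set φ' := Crit.sw φ S b q with hφ'
  have hbx : ¬ Miss φ x b := fun hm => h.nocommon hno hb.1 hb.2.1 hm hb.2.2
  have hqx' : ¬ Miss φ x q := fun hm => hqx ⟨hq0, hqD, hm⟩
  have hmsx : ms D φ' x = ms D φ x := by
    ext c
    rw [mem_ms, mem_ms]
    unfold InL
    by_cases hxS : x ∈ S
    · by_cases e1 : c = b
      · subst e1
        have : ¬ Miss φ' x c := by
          rw [hφ', miss_sw_in_left hxS]; exact hqx'
        exact ⟨fun hh => absurd hh.2.2 this, fun hh => absurd hh.2.2 hbx⟩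
      by_cases e2 : c = q
      · subst e2
        have : ¬ Miss φ' x c := by
          rw [hφ', miss_sw_in_right hxS]; exact hbx
        exact ⟨fun hh => absurd hh.2.2 this, fun hh => absurd hh.2.2 hqx'⟩
      rw [hφ', miss_sw_other e1 e2]
    · rw [hφ', miss_sw_out hxS]
  have hby : InL D φ' y q := ⟨hq0, hqD, by
    rw [hφ', miss_sw_in_right (mem_comp_self b q y)]; exact hb.2.2⟩
  have hsame : ∀ t, ms D φ t ∩ ms D φ x ⊆ ms D φ' t ∩ ms D φ' x := by
    intro t c hc
    rw [mem_inter] at hc ⊢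
    rw [hmsx]
    refine ⟨?_, hc.2⟩
    have h1 := mem_ms.1 hc.2
    have e1 : c ≠ b := by rintro rfl; exact hbx h1.2.2
    have e2 : c ≠ q := by rintro rfl; exact hqx' h1.2.2
    exact mem_ms.2 ((mem_ms.1 hc.1).sw_other e1 e2)
  set TA := T.filter (fun t => Able D φ' x q 10 t) with hTA
  have hTAm : ∀ t ∈ TA, t ≠ x ∧ t ≠ y ∧ φ' y t ≠ 0 ∧ 100 * G.degree t ≤ 67 * D ∧
      Able D φ' x q 10 t := by
    intro t ht
    obtain ⟨h1, h2⟩ := mem_filter.1 ht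
    obtain ⟨h3, h4, h5, h6⟩ := hTm t h1
    refine ⟨h3, h4, ?_, h6, h2⟩
    intro h0
    rcases h'.col y t (h.adj _ _ h5) h0 with ⟨e, _⟩ | ⟨_, e⟩
    · exact h.ne e.symm
    · exact h3 e
  set Tq := T'.filter (fun t => Miss φ t q) with hTq
  have hS1 : (Tq.filter (fun t => t ∈ S)).card ≤ 1 := by
    rw [card_le_one]
    intro t1 ht1 t2 ht2
    by_contra hne
    simp only [hTq, hT', mem_filter] at ht1 ht2
    exact h.three (v := y) hb.1 hq0 (mem_comp_self b q y) ht1.2 ht2.2 (hTm _ ht1.1.1.1).2.1.symm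
      (hTm _ ht2.1.1.1).2.1.symm hne (Or.inl hb.2.2) (Or.inr ht1.1.2) (Or.inr ht2.1.2)
  have hS2 : (Tq.filter (fun t => t ∈ S)).card + (Tq.filter (fun t => t ∉ S)).card = Tq.card :=
    card_filter_add_card_filter_not _
  have hTAc : TL.card + Tq.card ≤ TA.card + 1 := by
    have hsub : TL ∪ Tq.filter (fun t => t ∉ S) ⊆ TA := by
      intro t ht
      rw [mem_union] at ht
      rcases ht with ht | ht
      · obtain ⟨h1, h2⟩ := mem_filter.1 ht
        refine mem_filter.2 ⟨h1, Or.inr ?_⟩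
        have := card_le_card (hsame t)
        omega
      · simp only [hTq, hT', mem_filter] at ht
        refine mem_filter.2 ⟨ht.1.1.1, Or.inl ?_⟩
        rw [hφ', miss_sw_out ht.2]
        exact ht.1.2
    have hdisj : Disjoint TL (Tq.filter (fun t => t ∉ S)) := by
      rw [disjoint_left]
      intro t h1 h2
      simp only [hTq, hT', mem_filter] at h2
      exact h2.1.1.2 (mem_filter.1 h1).2
    have := card_le_card hsub
    rw [card_union_of_disjoint hdisj] at this
    omega
  set A := TA.image (φ' y) with hA
  have hAc : A.card = TA.card := by
    rw [hA, card_image_of_injOn]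
    intro t ht t' ht' e
    exact h'.inj y t t' (hTAm t ht).2.2.1 e
  have hAt : ∀ a ∈ A, ∃ t ∈ TA, φ' y t = a := fun a ha => mem_image.1 ha
  choose! tf htf1 htf2 using hAt
  have hA0 : ∀ a ∈ A, a ≠ 0 := fun a ha => by
    rw [← htf2 a ha]; exact (hTAm _ (htf1 a ha)).2.2.1
  have hAD : ∀ a ∈ A, a ≤ D := fun a ha => by
    rw [← htf2 a ha]; exact h'.le _ _
  have hAms : ∀ a ∈ A, ¬ InL D φ' x a := by
    intro a ha hl
    rcases (hTAm _ (htf1 a ha)).2.2.2.2 with hm | hm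
    · exact h'.F1 hno hby hl (htf2 a ha) (Or.inl rfl) hm
    · obtain ⟨c, hc⟩ := card_pos.1 (show 0 < (ms D φ' (tf a) ∩ ms D φ' x).card by omega)
      rw [mem_inter, mem_ms, mem_ms] at hc
      exact h'.F1 hno hby hl (htf2 a ha) (Or.inr hc.2) hc.1.2.2
  have hAK : ∀ a ∈ A, ∃ z, φ' x z = a := by
    intro a ha
    by_contra hn
    push Not at hn
    exact hAms a ha ⟨hA0 a ha, hAD a ha, hn⟩
  choose! zf hzf using hAK
  have hzinj : ∀ a ∈ A, ∀ a' ∈ A, zf a = zf a' → a = a' := by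
    intro a ha a' ha' e
    rw [← hzf a ha, ← hzf a' ha', e]
  -- size of A
  have hAbig : 10000 * k + 10000 ≤ 10000 * A.card + 3249 * D := by
    rw [hAc]
    have e1 : 325 * D * T.card ≤ 1000 * k * (TL.card + Tq.card) := by
      have f1 : 325 * D * TL.card ≤ 1000 * k * TL.card := Nat.mul_le_mul_right _ hk1.le
      have f2 : 325 * D * T'.card ≤ 1000 * k * Tq.card := by
        have f3 : 325 * D * T'.card ≤ 10 * (T'.card * (33 * D - 900)) := by
          have : 325 * D ≤ 10 * (33 * D - 900) := by omega
          calc 325 * D * T'.card ≤ 10 * (33 * D - 900) * T'.card := Nat.mul_le_mul_right _ this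
            _ = _ := by ring
        calc _ ≤ _ := f3
          _ ≤ 10 * (100 * Tq.card * k) := Nat.mul_le_mul_left _ hq
          _ = _ := by ring
      rw [← hTT, mul_add, mul_add]
      omega
    have e2 := Nat.mul_le_mul_left (1000 * k) hTAc
    rw [← hTc] at hbig
    have hkpos : 0 < k := by omega
    have e3 : 325 * D * T.card ≤ 1000 * k * (TA.card + 1) := e1.trans e2
    zify at *
    by_contra hn
    push Not at hn
    have : (10000 * (TA.card : ℤ) + 3249 * D) * k ≤ (10000 * k + 9999) * k := by
      apply mul_le_mul_of_nonneg_right <;> omega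
    nlinarith
  have hmx' := h'.card_ms_x
  have hAu : (ms D φ' x ∪ A).card = (ms D φ' x).card + A.card := by
    apply card_union_of_disjoint
    rw [disjoint_left]
    intro a h1 h2
    exact hAms a h2 (mem_ms.1 h1)
  have hAs : ms D φ' x ∪ A ⊆ Finset.Icc 1 D := by
    apply union_subset (ms_sub _ _ _)
    intro a ha
    exact mem_Icc.2 ⟨Nat.pos_of_ne_zero (hA0 a ha), hAD a ha⟩
  have key := h'.lemM2 hno (A := A) (Q := Finset.Icc 1 D) (t := tf) (z := zf) hby
    (by norm_num; omega) hyX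
    (fun a ha => ⟨hA0 a ha, htf2 a ha, (hTAm _ (htf1 a ha)).2.2.2.2⟩) hzf (by omega)
    (by
      intro w hw hwx hwd
      have h1 := h'.card_ms_other hwx (show w ≠ y by rintro rfl; exact hyX hw)
      have h2 := card_inter (n := D / 200 + 1) (ms_sub D φ' w) hAs (by rw [hAu]; omega)
      omega)
    (by
      intro a ha w hw hwx hwb
      rw [mem_lowN] at hw
      have hwy : w ≠ y := by rintro rfl; exact hyX hw.1
      rw [mem_Icc]
      refine ⟨Nat.pos_of_ne_zero ?_, h'.le _ _⟩
      intro h0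
      rcases h'.col _ _ hw.2.1 h0 with ⟨_, e⟩ | ⟨_, e⟩
      · exact hwy e
      · exact hwx e)
  refine ⟨A.image zf, ?_, ?_, ?_⟩
  · intro z hz
    obtain ⟨a, ha, rfl⟩ := mem_image.1 hz
    rw [SimpleGraph.mem_neighborFinset]
    apply h'.adj
    rw [hzf a ha]; exact hA0 a ha
  · rw [card_image_of_injOn (fun a ha a' ha' e => hzinj a ha a' ha' e)]
    omega
  · rw [sum_image (fun a ha a' ha' e => hzinj a ha a' ha' e), card_image_of_injOn
      (fun a ha a' ha' e => hzinj a ha a' ha' e)]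
    simpa using key

end

/-- Cauchy-Schwarz for reciprocals -/
lemma harm {Z : Finset V} {f : V → ℕ} (hf : ∀ z ∈ Z, 1 ≤ f z) {M : ℝ}
    (hM : ((∑ z ∈ Z, f z : ℕ) : ℝ) ≤ M) : (Z.card : ℝ) ^ 2 ≤ M * ∑ z ∈ Z, 1 / (f z : ℝ) := by
  have hpos : ∀ z ∈ Z, (0 : ℝ) < f z := fun z hz => by exact_mod_cast hf z hz
  have h1 := sum_sq_le_sum_mul_sum_of_sq_le_mul Z (r := fun _ => (1 : ℝ)) (f := fun z => (f z : ℝ))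
    (g := fun z => 1 / (f z : ℝ)) (fun z hz => (hpos z hz).le)
    (fun z hz => by have := hpos z hz; positivity)
    (fun z hz => by have := hpos z hz; field_simp; exact le_refl _)
  simp only [sum_const, nsmul_eq_mul, mul_one] at h1
  refine h1.trans ?_
  push_cast at hM
  apply mul_le_mul_of_nonneg_right hM
  exact sum_nonneg (fun z hz => by have := hpos z hz; positivity)

/-- combinatorial-numerical core for tiny vertices -/
lemma tiny_core {N : Finset V} {b B : V → ℕ} {F : V → Prop} [DecidablePred F]
    (hk : 3 ≤ N.card) (hb : ∀ y ∈ N, 1 ≤ b y) (hbB : ∀ y ∈ N, b y ≤ B y)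
    (hE : ∀ y ∈ N, ∃ Z ⊆ N, y ∉ Z ∧ Z.card = B y ∧ ∑ z ∈ Z, b z + 1 ≤ N.card)
    (hF : ∀ y ∈ N, B y = b y → N.card ≤ 3 * b y + 1 → F y) :
    1 ≤ ∑ y ∈ N, (if F y then (2 / 5 : ℝ) else 39 / 100) / b y := by
  classical
  have hpos : ∀ z ∈ N, (0 : ℝ) < b z := fun z hz => by exact_mod_cast hb z hz
  have red : (100 / 39 : ℝ) ≤ ∑ y ∈ N, 1 / (b y : ℝ) →
      1 ≤ ∑ y ∈ N, (if F y then (2 / 5 : ℝ) else 39 / 100) / b y := by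
    intro h1
    have h2 : ∑ y ∈ N, (39 / 100 : ℝ) * (1 / (b y : ℝ)) ≤
        ∑ y ∈ N, (if F y then (2 / 5 : ℝ) else 39 / 100) / b y := by
      apply sum_le_sum
      intro y hy
      have := hpos y hy
      rw [mul_one_div]
      apply div_le_div_of_nonneg_right _ this.le
      split_ifs <;> norm_num
    rw [← mul_sum] at h2
    linarith
  have hne : N.Nonempty := card_pos.1 (by omega)
  obtain ⟨y, hy, hmax⟩ := exists_max_image N b hne
  set m := b y with hm
  obtain ⟨Z, hZN, hyZ, hZc, hZs⟩ := hE y hy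
  obtain ⟨W, hWZ, hWc⟩ := exists_subset_card_eq (s := Z) (n := m) (by rw [hZc]; exact hbB y hy)
  have hm1 : 1 ≤ m := hb y hy
  have hmk : m + 1 ≤ N.card := by
    have : W ⊆ N.erase y := fun w hw =>
      mem_erase.2 ⟨by rintro rfl; exact hyZ (hWZ hw), hZN (hWZ hw)⟩
    have := card_le_card this
    rw [card_erase_of_mem hy] at this
    omega
  obtain ⟨j, hj⟩ : ∃ j, N.card = j + 1 := ⟨N.card - 1, by omega⟩
  have hWN : W ⊆ N := hWZ.trans hZN
  have hWs : ∑ z ∈ W, b z ≤ j := by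
    have := sum_le_sum_of_subset (f := b) hWZ
    omega
  have c1 := harm (M := (j : ℝ)) (fun z hz => hb z (hWN hz)) (by exact_mod_cast hWs)
  have c2 : ((N.card : ℝ) - m) / m ≤ ∑ z ∈ N \ W, 1 / (b z : ℝ) := by
    have e1 : (N \ W).card • (1 / (m : ℝ)) ≤ ∑ z ∈ N \ W, 1 / (b z : ℝ) := by
      apply card_nsmul_le_sum
      intro z hz
      have hz := (mem_sdiff.1 hz).1
      apply one_div_le_one_div_of_le (hpos z hz)
      exact_mod_cast hmax z hz
    have e2 := card_sdiff_add_card_eq_card hWN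
    have e3 : ((N \ W).card : ℝ) = N.card - m := by
      rw [← e2, hWc]; push_cast; ring
    rw [nsmul_eq_mul, e3, mul_one_div] at e1
    exact e1
  have c3 := sum_sdiff (f := fun z => 1 / (b z : ℝ)) hWN
  have main : (139 : ℝ) / 39 * (m * j) ≤ m ^ 3 + j ^ 2 + j →
      (100 / 39 : ℝ) ≤ ∑ y ∈ N, 1 / (b y : ℝ) := by
    intro hh
    rw [← c3]
    have hj0 : (0 : ℝ) < j := by
      have : 0 < j := by omega
      exact_mod_cast this
    have hm0 : (0 : ℝ) < m := by exact_mod_cast hm1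
    have d1 : (m : ℝ) ^ 2 / j ≤ ∑ z ∈ W, 1 / (b z : ℝ) := by
      rw [div_le_iff₀ hj0, ← hWc]; linarith
    have d2 : (100 / 39 : ℝ) ≤ (m : ℝ) ^ 2 / j + ((N.card : ℝ) - m) / m := by
      rw [hj, div_add_div _ _ hj0.ne' hm0.ne', le_div_iff₀ (by positivity)]
      push_cast
      nlinarith
    linarith
  by_cases hm3 : 3 ≤ m
  · apply red
    apply main
    by_cases hm4 : 4 ≤ m
    · have : (4 : ℝ) ≤ m := by exact_mod_cast hm4
      nlinarith [sq_nonneg (2 * (j : ℝ) + 1 - 139 / 39 * m), sq_nonneg (m : ℝ),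
        mul_nonneg (sq_nonneg (m : ℝ)) (sub_nonneg.2 this)]
    · have : m = 3 := by omega
      rw [this]
      push_cast
      nlinarith [sq_nonneg (2 * (j : ℝ) - 10), sq_nonneg (2 * (j : ℝ) - 9)]
  by_cases hk6 : 6 ≤ N.card
  · apply red
    apply main
    have : (5 : ℝ) ≤ j := by
      have : 5 ≤ j := by omega
      exact_mod_cast this
    have hm' : m = 1 ∨ m = 2 := by omega
    rcases hm' with h | h <;> rw [h] <;> push_cast <;> nlinarith
  -- small cases
  have hb12 : ∀ z ∈ N, b z = 1 ∨ b z = 2 := by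
    intro z hz
    have := hmax z hz
    have := hb z hz
    omega
  have hcount : ∀ W ⊆ N, ∑ z ∈ W, b z + (W.filter (fun z => b z = 1)).card = 2 * W.card := by
    intro W hW
    rw [card_filter, ← sum_add_distrib, mul_comm, ← smul_eq_mul, ← sum_const]
    apply sum_congr rfl
    intro z hz
    rcases hb12 z (hW hz) with h | h <;> simp [h]
  set o := (N.filter (fun z => b z = 1)).card with ho
  have hsum : ∑ y ∈ N, 1 / (b y : ℝ) = ((N.card : ℝ) + o) / 2 := by
    have : ∑ y ∈ N, 1 / (b y : ℝ) = ∑ y ∈ N, ((1 : ℝ) + (if b y = 1 then 1 else 0)) / 2 := by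
      apply sum_congr rfl
      intro z hz
      rcases hb12 z hz with h | h <;> simp [h]
    rw [this, ← sum_div, sum_add_distrib, ho]
    simp
  by_cases h6 : 6 ≤ N.card + o
  · apply red
    rw [hsum]
    have : (6 : ℝ) ≤ (N.card : ℝ) + o := by exact_mod_cast h6
    linarith
  have hm2 : m = 2 := by
    by_contra hne2
    have hall : ∀ z ∈ N, b z = 1 := by
      intro z hz
      have := hmax z hz
      have := hb z hz
      omega
    have : o = N.card := by rw [ho, filter_true_of_mem hall]
    omega
  have hZo : ∀ W ⊆ N, (W.filter (fun z => b z = 1)).card ≤ o := fun W hW =>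
    card_le_card (filter_subset_filter _ hW)
  have ho5 : 5 ≤ N.card + o := by
    have h1 := hcount Z hZN
    have h2 := hZo Z hZN
    have h3 := hbB y hy
    omega
  have hfull : ∀ z ∈ N, F z := by
    intro z hz
    obtain ⟨W, hWN, hzW, hWc, hWs⟩ := hE z hz
    have h1 := hcount W hWN
    have h2 := hZo W hWN
    have h3 := hbB z hz
    rcases hb12 z hz with h | h
    · have h4 : (W.filter (fun z => b z = 1)).card + 1 ≤ o := by
        have : W.filter (fun z => b z = 1) ⊆ (N.filter (fun z => b z = 1)).erase z := by
          intro w hw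
          rw [mem_filter] at hw
          refine mem_erase.2 ⟨by rintro rfl; exact hzW hw.1, mem_filter.2 ⟨hWN hw.1, hw.2⟩⟩
        have h5 := card_le_card this
        rw [card_erase_of_mem (mem_filter.2 ⟨hz, h⟩)] at h5
        have h6 : 0 < o := card_pos.2 ⟨z, mem_filter.2 ⟨hz, h⟩⟩
        omega
      apply hF z hz <;> omega
    · apply hF z hz <;> omega
  have hs : ∑ y ∈ N, (if F y then (2 / 5 : ℝ) else 39 / 100) / b y =
      2 / 5 * ∑ y ∈ N, 1 / (b y : ℝ) := by
    rw [mul_sum]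
    apply sum_congr rfl
    intro z hz
    rw [if_pos (hfull z hz), mul_one_div]
  rw [hs, hsum]
  have : (5 : ℝ) ≤ (N.card : ℝ) + o := by exact_mod_cast ho5
  linarith

section
variable [Fintype V] [DecidableRel G.Adj]

/-- saturated vertices -/
def Sat (G : SimpleGraph V) [DecidableRel G.Adj] (X : Finset V) (D : ℕ) (x : V) : Prop :=
  250 ≤ ∑ y ∈ G.neighborFinset x, 1 / ((lowN G X D y).card : ℝ)

lemma unsat_claim (hcol : ∀ x y, G.Adj x y → ∃ φ, Col G D x y φ) (hno : NoCol G D)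
    (hdeg : ∀ v, G.degree v ≤ D)
    (hD : 5 ^ 25 ≤ D) {X : Finset V} (hX : ∀ u ∈ X, ∀ v ∈ X, u ≠ v → ¬ G.Adj u v) (hx : x ∈ X)
    (hk1 : 10 ^ 13 ≤ G.degree x) (hk2 : 100 * G.degree x ≤ 67 * D) (hs : ¬ Sat G X D x) :
    325 * D < 1000 * G.degree x ∧ ∀ y, G.Adj x y →
      (lowN G X D y).card * 3250 * D + 3249 * D * G.degree x <
        (10000 * G.degree x + 20000) * G.degree x + 3 * 3250 * D := by
  classical
  unfold Sat at hs
  push Not at hs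
  have hB1 : ∀ z ∈ G.neighborFinset x, 1 ≤ (lowN G X D z).card := by
    intro z hz
    rw [SimpleGraph.mem_neighborFinset] at hz
    exact card_pos.2 ⟨x, mem_lowN.2 ⟨hx, hz.symm, hk2⟩⟩
  have hZ : ∀ Z ⊆ G.neighborFinset x, ∀ M : ℝ, 0 < M →
      ((∑ z ∈ Z, (lowN G X D z).card : ℕ) : ℝ) ≤ M →
      (Z.card : ℝ) ^ 2 ≤ M * 250 := by
    intro Z hZ M hM0 hM
    have h1 := harm (fun z hz => hB1 z (hZ hz)) hM
    have h2 : ∑ z ∈ Z, 1 / ((lowN G X D z).card : ℝ) ≤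
        ∑ y ∈ G.neighborFinset x, 1 / ((lowN G X D y).card : ℝ) :=
      sum_le_sum_of_subset_of_nonneg hZ (fun z _ _ => by positivity)
    refine h1.trans (mul_le_mul_of_nonneg_left (by linarith) hM0.le)
  have hk1' : (10 ^ 13 : ℝ) ≤ G.degree x := by exact_mod_cast hk1
  have hD' : (5 ^ 25 : ℝ) ≤ D := by exact_mod_cast hD
  have hA : 325 * D < 1000 * G.degree x := by
    by_contra hle
    push Not at hle
    have hall : ∀ z ∈ G.neighborFinset x, 251 * (lowN G X D z).card ≤ G.degree x := by
      intro z hz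
      rw [SimpleGraph.mem_neighborFinset] at hz
      by_contra hgt
      push Not at hgt
      obtain ⟨φ, h⟩ := hcol x z hz
      obtain ⟨Z, hZN, hZc, hZs⟩ := h.lemM3 hno hdeg hD hX hx hle
      have hZk : Z.card ≤ G.degree x := by
        rw [← G.card_neighborFinset_eq_degree]; exact card_le_card hZN
      have h2 := hZ Z hZN (450002 * G.degree x) (by positivity) (by
        have : ∑ z ∈ Z, (lowN G X D z).card ≤ 450002 * G.degree x := by omega
        exact_mod_cast this)
      have h3 : G.degree x ≤ 252 * Z.card := by norm_num at hk1; omega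
      have h3' : (G.degree x : ℝ) ≤ 252 * Z.card := by exact_mod_cast h3
      nlinarith
    have h1 : (G.neighborFinset x).card • (251 / (G.degree x : ℝ)) ≤
        ∑ y ∈ G.neighborFinset x, 1 / ((lowN G X D y).card : ℝ) := by
      apply card_nsmul_le_sum
      intro z hz
      have h2 : (0 : ℝ) < (lowN G X D z).card := by exact_mod_cast hB1 z hz
      have h3 : (251 : ℝ) * (lowN G X D z).card ≤ G.degree x := by exact_mod_cast hall z hz
      rw [div_le_div_iff₀ (by linarith) h2]
      linarith
    rw [nsmul_eq_mul, G.card_neighborFinset_eq_degree, mul_div_cancel₀] at h1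
    · linarith
    · have : (0 : ℝ) < G.degree x := by linarith
      exact this.ne'
  refine ⟨hA, ?_⟩
  intro y hy
  by_contra hle
  push Not at hle
  obtain ⟨φ, h⟩ := hcol x y hy
  obtain ⟨Z, hZN, hZc, hZs⟩ := h.lemM4 hno hdeg hD hX hx hA hk2 hle
  have hZk : Z.card ≤ G.degree x := by
    rw [← G.card_neighborFinset_eq_degree]; exact card_le_card hZN
  have hkD := hdeg x
  have h2 := hZ Z hZN (450002 * D) (by positivity) (by
    have : ∑ z ∈ Z, (lowN G X D z).card ≤ 450002 * D := by omega
    exact_mod_cast this)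
  have h3 : D ≤ 10000 * Z.card := by omega
  have h3' : (D : ℝ) ≤ 10000 * Z.card := by exact_mod_cast h3
  nlinarith

end

lemma numB {D k l : ℝ} (hD' : 298023223876953125 ≤ D) (hk1' : 325 * D < 1000 * k)
    (hx0l' : 100 * k ≤ 67 * D)
    (hBr : l * 3250 * D + 3249 * D * k < (10000 * k + 20000) * k + 3 * 3250 * D) :
    (D + 1 - k) / D + 4 * (k - 2) / D ^ 2 + l * (1 / k) + (k - l) * (100 / (67 * D)) <
      7 / 5 - 1 / 250 := by
  have hD0 : 0 < D := by linarith
  have hk0 : 0 < k := by linarith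
  -- normalise
  obtain ⟨c, hcdef⟩ : ∃ c : ℝ, c = k / D := ⟨_, rfl⟩
  have hkc : k = c * D := by rw [hcdef]; field_simp
  have hc1 : 325 / 1000 < c := by
    rw [hcdef, lt_div_iff₀ hD0]; linarith
  have hc2 : c ≤ 67 / 100 := by
    rw [hcdef, div_le_iff₀ hD0]; linarith
  obtain ⟨q, hq⟩ : ∃ q : ℝ, q = l / D := ⟨_, rfl⟩
  have hlq : l = q * D := by rw [hq]; field_simp
  obtain ⟨e, he⟩ : ∃ e : ℝ, e = 1 / D := ⟨_, rfl⟩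
  have heD : e * D = 1 := by rw [he]; field_simp
  have he0 : 0 < e := by rw [he]; positivity
  have he1 : e ≤ 1 / 10 ^ 10 := by
    rw [he]; apply one_div_le_one_div_of_le (by norm_num)
    linarith
  have hqb : q * 3250 ≤ 10000 * c ^ 2 - 3249 * c + 30000 * e := by
    rw [hkc, hlq] at hBr
    have : (q * 3250) * D ^ 2 ≤ (10000 * c ^ 2 - 3249 * c + 30000 * e) * D ^ 2 := by
      have : e * D ^ 2 = D := by rw [sq, ← mul_assoc, heD, one_mul]
      nlinarith
    exact le_of_mul_le_mul_right this (by positivity)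
  have t1 : l * (1 / k) = q / c := by
    rw [hlq, hkc]; field_simp
  have t2 : (k - l) * (100 / (67 * D)) = (c - q) * (100 / 67) := by
    rw [hlq, hkc]; field_simp
  have t3 : (D + 1 - k) / D = 1 + e - c := by
    rw [hkc, he]; field_simp
  have t4 : 4 * (k - 2) / D ^ 2 ≤ 4 * e := by
    rw [he, hkc, div_le_iff₀ (by positivity)]
    have : 4 * (1 / D) * D ^ 2 = 4 * D := by field_simp
    rw [this]
    nlinarith
  have t5 : q / c + (c - q) * (100 / 67) ≤
      (10000 * c - 3249) / 3250 + 100 * e + (c - (10000 * c ^ 2 - 3249 * c) / 3250) * (100 / 67) := by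
    have hc0 : 0 < c := by linarith
    have v1 : q / c + (c - q) * (100 / 67) = c * (100 / 67) + q * (1 / c - 100 / 67) := by
      field_simp
      ring
    have v2 : 0 ≤ 1 / c - 100 / 67 := by
      have : (100 : ℝ) / 67 ≤ 1 / c := by
        rw [div_le_div_iff₀ (by norm_num) hc0]; linarith
      linarith
    have v3 : 1 / c ≤ 4 := by rw [div_le_iff₀ hc0]; linarith
    have v4 : q * (1 / c - 100 / 67) ≤
        ((10000 * c ^ 2 - 3249 * c) / 3250 + 10 * e) * (1 / c - 100 / 67) :=
      mul_le_mul_of_nonneg_right (by linarith) v2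
    have v5 : (10000 * c ^ 2 - 3249 * c) / 3250 * (1 / c) = (10000 * c - 3249) / 3250 := by
      field_simp
    nlinarith
  rw [t1, t2, t3]
  nlinarith [sq_nonneg (c - 551 / 1000)]

section
variable [Fintype V] [DecidableRel G.Adj]

lemma rsum (h : Col G D x y φ) (hno : NoCol G D) (hdeg : ∀ v, G.degree v ≤ D) (hD : 5 ^ 25 ≤ D)
    {R : Finset V} (hR : ∀ w ∈ R, 325 * D < 1000 * G.degree w) [DecidableEq V] :
    ∃ P ⊆ G.neighborFinset y, P.card + G.degree x = D + 1 ∧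
      (∀ w ∈ P, D + 2 ≤ G.degree w + G.degree x) ∧
      ∑ w ∈ R, 1 / (G.degree w : ℝ) ≤ ((D : ℝ) + 1 - G.degree x) / D +
        4 * ((G.degree x : ℝ) - 2) / (D : ℝ) ^ 2 + ∑ w ∈ R \ P, 1 / (G.degree w : ℝ) := by
  obtain ⟨h1, h2, h3, h4⟩ := h.PLprop hno hdeg
  set P := PL D φ x y with hP
  have hD0 : (0 : ℝ) < D := by
    have : 0 < D := lt_of_lt_of_le (by norm_num) hD
    exact_mod_cast this
  refine ⟨P, h1, h3, ?_, ?_⟩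
  · intro w hw
    have h5 := single_le_sum (f := fun w => D - G.degree w) (fun _ _ => Nat.zero_le _) hw
    have h6 := hdeg w
    omega
  · have e1 : ∑ w ∈ R ∩ P, 1 / (G.degree w : ℝ) ≤
        ∑ w ∈ R ∩ P, (1 / (D : ℝ) + 4 * ((D - G.degree w : ℕ) : ℝ) / (D : ℝ) ^ 2) := by
      apply sum_le_sum
      intro w hw
      have f1 := hR w (mem_inter.1 hw).1
      have f2 := hdeg w
      rw [Nat.cast_sub f2]
      have f1' : (325 : ℝ) * D < 1000 * G.degree w := by exact_mod_cast f1
      have f2' : (G.degree w : ℝ) ≤ D := by exact_mod_cast f2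
      have f3 : (0 : ℝ) < G.degree w := by linarith
      have : 1 / (D : ℝ) + 4 * ((D : ℝ) - G.degree w) / (D : ℝ) ^ 2 - 1 / (G.degree w : ℝ) =
        ((D : ℝ) - G.degree w) * (4 * G.degree w - D) / ((D : ℝ) ^ 2 * G.degree w) := by
        field_simp
        ring
      have : 0 ≤ ((D : ℝ) - G.degree w) * (4 * G.degree w - D) / ((D : ℝ) ^ 2 * G.degree w) := by
        apply div_nonneg _ (by positivity)
        apply mul_nonneg <;> linarith
      linarith
    have e2 : ∑ w ∈ R ∩ P, (1 / (D : ℝ) + 4 * ((D - G.degree w : ℕ) : ℝ) / (D : ℝ) ^ 2) ≤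
        ∑ w ∈ P, (1 / (D : ℝ) + 4 * ((D - G.degree w : ℕ) : ℝ) / (D : ℝ) ^ 2) :=
      sum_le_sum_of_subset_of_nonneg inter_subset_right (fun w _ _ => by positivity)
    have e2' : ∑ w ∈ P, (1 / (D : ℝ) + 4 * ((D - G.degree w : ℕ) : ℝ) / (D : ℝ) ^ 2) =
        (P.card : ℝ) / D + 4 * (∑ w ∈ P, ((D - G.degree w : ℕ) : ℝ)) / (D : ℝ) ^ 2 := by
      rw [sum_add_distrib, sum_const, nsmul_eq_mul, ← sum_div, ← mul_sum, mul_one_div]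
    rw [e2'] at e2
    have e3 : (P.card : ℝ) = (D : ℝ) + 1 - G.degree x := by
      have : (P.card : ℝ) + G.degree x = D + 1 := by exact_mod_cast h3
      linarith
    have e4 : (∑ w ∈ P, ((D - G.degree w : ℕ) : ℝ)) ≤ (G.degree x : ℝ) - 2 := by
      have : (∑ w ∈ P, ((D - G.degree w : ℕ) : ℝ)) + 2 ≤ G.degree x := by exact_mod_cast h4
      linarith
    have e5 : 4 * (∑ w ∈ P, ((D - G.degree w : ℕ) : ℝ)) / (D : ℝ) ^ 2 ≤
        4 * ((G.degree x : ℝ) - 2) / (D : ℝ) ^ 2 := by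
      apply div_le_div_of_nonneg_right _ (by positivity)
      linarith
    rw [e3] at e2
    have e6 := sum_inter_add_sum_sdiff R P (fun w => 1 / (G.degree w : ℝ))
    linarith

/-- vertices with individual weights -/
def RC (G : SimpleGraph V) [DecidableRel G.Adj] (X : Finset V) (D : ℕ) (x : V) : Prop :=
  67 * D < 100 * G.degree x ∨ (10 ^ 13 ≤ G.degree x ∧ ¬ Sat G X D x)

/-- full vertices -/
def Full (G : SimpleGraph V) [DecidableRel G.Adj] (X : Finset V) (D : ℕ) (y : V) : Prop :=
  (lowN G X D y).card = (tinyN G X y).card ∧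
    ∃ x ∈ tinyN G X y, G.degree x ≤ 3 * (tinyN G X y).card + 1

open Classical in
/-- discharging weights -/
noncomputable def om (G : SimpleGraph V) [DecidableRel G.Adj] (X : Finset V) (D : ℕ) (y x : V) : ℝ :=
  (if G.degree x < 10 ^ 13 then
    (if Full G X D y then (2 / 5 : ℝ) else 39 / 100) / (tinyN G X y).card else 0) +
  (if 10 ^ 13 ≤ G.degree x ∧ 100 * G.degree x ≤ 67 * D then
    1 / 250 * (1 / ((lowN G X D y).card : ℝ)) else 0) +
  (if RC G X D x then 1 / (G.degree x : ℝ) else 0)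

lemma receive (hcol : ∀ x y, G.Adj x y → ∃ φ, Col G D x y φ) (hno : NoCol G D)
    (hdeg : ∀ v, G.degree v ≤ D) (hmin : ∀ v, 3 ≤ G.degree v)
    (hD : 5 ^ 25 ≤ D) {X : Finset V} (hX : ∀ u ∈ X, ∀ v ∈ X, u ≠ v → ¬ G.Adj u v) (hx : x ∈ X) :
    1 ≤ ∑ y ∈ G.neighborFinset x, om G X D y x := by
  classical
  have hcard := G.card_neighborFinset_eq_degree x
  by_cases hR : RC G X D x
  · have h1 : (G.neighborFinset x).card • (1 / (G.degree x : ℝ)) ≤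
        ∑ y ∈ G.neighborFinset x, om G X D y x := by
      apply card_nsmul_le_sum
      intro y hy
      unfold om
      rw [if_pos hR]
      have : 0 ≤ (if G.degree x < 10 ^ 13 then
        (if Full G X D y then (2 / 5 : ℝ) else 39 / 100) / (tinyN G X y).card else 0) := by
        split_ifs <;> positivity
      have : 0 ≤ (if 10 ^ 13 ≤ G.degree x ∧ 100 * G.degree x ≤ 67 * D then
        1 / 250 * (1 / ((lowN G X D y).card : ℝ)) else 0) := by
        split_ifs <;> positivity
      linarith
    rw [nsmul_eq_mul, hcard, mul_one_div_cancel] at h1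
    · exact h1
    · have := hmin x
      have : G.degree x ≠ 0 := by omega
      exact_mod_cast this
  have hlow : 100 * G.degree x ≤ 67 * D := by
    by_contra hn
    exact hR (Or.inl (by omega))
  by_cases ht : G.degree x < 10 ^ 13
  · have e : ∀ y ∈ G.neighborFinset x, om G X D y x =
        (if Full G X D y then (2 / 5 : ℝ) else 39 / 100) / (tinyN G X y).card := by
      intro y hy
      unfold om
      rw [if_pos ht, if_neg hR,
        if_neg (show ¬ (10 ^ 13 ≤ G.degree x ∧ 100 * G.degree x ≤ 67 * D) by omega)]
      ring
    rw [sum_congr rfl e]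
    have hxt : ∀ y ∈ G.neighborFinset x, x ∈ tinyN G X y := by
      intro y hy
      rw [SimpleGraph.mem_neighborFinset] at hy
      exact mem_tinyN.2 ⟨hx, hy.symm, ht⟩
    apply tiny_core (B := fun y => (lowN G X D y).card)
    · rw [hcard]; exact hmin x
    · intro y hy
      exact card_pos.2 ⟨x, hxt y hy⟩
    · intro y hy
      exact card_le_card (tiny_sub_low hD)
    · intro y hy
      rw [SimpleGraph.mem_neighborFinset] at hy
      obtain ⟨φ, h⟩ := hcol x y hy
      obtain ⟨Z, h1, h2, h3, h4⟩ := h.lemE hno hdeg hD hX hx ht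
      exact ⟨Z, h1, h2, h3, by rw [hcard]; exact h4⟩
    · intro y hy h1 h2
      rw [hcard] at h2
      exact ⟨h1, x, hxt y hy, h2⟩
  · push Not at ht
    have hs : Sat G X D x := by
      by_contra hn
      exact hR (Or.inr ⟨ht, hn⟩)
    have e : ∀ y ∈ G.neighborFinset x, om G X D y x = 1 / 250 * (1 / ((lowN G X D y).card : ℝ)) := by
      intro y hy
      unfold om
      rw [if_neg (show ¬ (G.degree x < 10 ^ 13) by omega), if_neg hR, if_pos ⟨ht, hlow⟩]
      ring
    rw [sum_congr rfl e, ← mul_sum]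
    unfold Sat at hs
    linarith

set_option maxHeartbeats 1000000 in
lemma give (hcol : ∀ x y, G.Adj x y → ∃ φ, Col G D x y φ) (hno : NoCol G D)
    (hdeg : ∀ v, G.degree v ≤ D) (hmin : ∀ v, 3 ≤ G.degree v)
    (hD : 5 ^ 25 ≤ D) {X : Finset V} (hX : ∀ u ∈ X, ∀ v ∈ X, u ≠ v → ¬ G.Adj u v)
    {U : Finset V} (hU : ∀ x, x ∈ U ↔ x ∈ X ∧ G.Adj y x) :
    ∑ x ∈ U, om G X D y x < 7 / 5 := by
  classical
  set R := U.filter (fun x => RC G X D x) with hRdef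
  set w : ℝ := (if Full G X D y then (2 / 5 : ℝ) else 39 / 100) with hw
  set M := U.filter (fun x => 10 ^ 13 ≤ G.degree x ∧ 100 * G.degree x ≤ 67 * D) with hM
  have hTU : U.filter (fun x => G.degree x < 10 ^ 13) = tinyN G X y := by
    ext v
    rw [mem_filter, mem_tinyN, hU, and_assoc]
  have hw0 : 0 < w := by rw [hw]; split_ifs <;> norm_num
  have hsum : ∑ x ∈ U, om G X D y x = (tinyN G X y).card * (w / (tinyN G X y).card) +
      M.card * (1 / 250 * (1 / ((lowN G X D y).card : ℝ))) + ∑ x ∈ R, 1 / (G.degree x : ℝ) := by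
    unfold om
    rw [sum_add_distrib, sum_add_distrib, ← sum_filter, ← sum_filter, ← sum_filter, hTU]
    simp only [sum_const, nsmul_eq_mul]
    rfl
  have hT1 : ((tinyN G X y).card : ℝ) * (w / (tinyN G X y).card) ≤ w := by
    by_cases e : (tinyN G X y).card = 0
    · rw [e]; simp; exact hw0.le
    · rw [mul_div_cancel₀]
      exact_mod_cast e
  have hML : M ⊆ lowN G X D y := by
    intro v hv
    rw [hM, mem_filter, hU] at hv
    exact mem_lowN.2 ⟨hv.1.1, hv.1.2, hv.2.2⟩
  have hM1 : (M.card : ℝ) * (1 / 250 * (1 / ((lowN G X D y).card : ℝ))) ≤ 1 / 250 := by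
    by_cases e : (lowN G X D y).card = 0
    · rw [e]; simp
    · have e' : (0 : ℝ) < (lowN G X D y).card := by exact_mod_cast Nat.pos_of_ne_zero e
      have : (M.card : ℝ) ≤ (lowN G X D y).card := by exact_mod_cast card_le_card hML
      rw [mul_one_div, ← mul_div_assoc, div_le_iff₀ e']
      linarith
  have hUN : ∀ v ∈ U, G.Adj y v := fun v hv => ((hU v).1 hv).2
  have hRlow : ∀ v ∈ R, 325 * D < 1000 * G.degree v := by
    intro v hv
    obtain ⟨h1, h2⟩ := mem_filter.1 hv
    by_cases h3 : 67 * D < 100 * G.degree v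
    · omega
    · have h4 := h2.resolve_left h3
      exact (unsat_claim hcol hno hdeg hD hX ((hU v).1 h1).1 h4.1 (by omega) h4.2).1
  have hD' : (298023223876953125 : ℝ) ≤ D := by
    have : 298023223876953125 ≤ D := by norm_num at hD; exact hD
    exact_mod_cast this
  have hD0 : (0 : ℝ) < D := by linarith
  have hyD : (G.neighborFinset y).card ≤ D := by
    rw [G.card_neighborFinset_eq_degree]; exact hdeg y
  have hRN : R ⊆ G.neighborFinset y := by
    intro v hv
    rw [SimpleGraph.mem_neighborFinset]
    exact hUN v (mem_filter.1 hv).1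
  have hinv : ∀ v ∈ R, 1 / (G.degree v : ℝ) ≤ 4 / D := by
    intro v hv
    have h1 : (325 : ℝ) * D < 1000 * G.degree v := by exact_mod_cast hRlow v hv
    rw [div_le_div_iff₀ (by linarith) hD0]
    linarith
  have hinvH : ∀ v, 67 * D < 100 * G.degree v → 1 / (G.degree v : ℝ) ≤ 100 / (67 * D) := by
    intro v hv
    have h1 : (67 : ℝ) * D < 100 * G.degree v := by exact_mod_cast hv
    rw [div_le_div_iff₀ (by linarith) (by linarith)]
    linarith
  have hNP : ∀ P ⊆ G.neighborFinset y, ∀ k, P.card + k = D + 1 →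
      (G.neighborFinset y \ P).card + 1 ≤ k := by
    intro P hP k hk
    have := card_sdiff_add_card_eq_card hP
    omega
  rw [hsum]
  by_cases hT : (tinyN G X y).Nonempty
  · by_cases hF : Full G X D y
    · obtain ⟨hF1, x0, hx0, hk⟩ := hF
      have hw2 : w = 2 / 5 := by rw [hw, if_pos ⟨hF1, x0, hx0, hk⟩]
      have hM0 : M = ∅ := by
        have h1 : tinyN G X y = lowN G X D y :=
          eq_of_subset_of_card_le (tiny_sub_low hD) hF1.le
        rw [eq_empty_iff_forall_notMem]
        intro v hv
        have h2 := hML hv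
        rw [← h1, mem_tinyN] at h2
        have h3 := (mem_filter.1 hv).2.1
        omega
      have hx0' := mem_tinyN.1 hx0
      obtain ⟨φ, h⟩ := hcol x0 y hx0'.2.1.symm
      obtain ⟨P, hP1, hP2, hP3, hP4⟩ := rsum h hno hdeg hD hRlow
      set k := G.degree x0 with hkdef
      have hRH : ∀ v ∈ R, 67 * D < 100 * G.degree v := by
        intro v hv
        obtain ⟨h1, h2⟩ := mem_filter.1 hv
        rcases h2 with h2 | h2
        · exact h2
        · by_contra h3
          have : v ∈ M := mem_filter.2 ⟨h1, h2.1, by omega⟩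
          rw [hM0] at this
          simp at this
      have hc : (R \ P).card + (tinyN G X y).card + 1 ≤ k := by
        have h1 := hNP P hP1 k hP2
        have h2 : (R \ P) ∪ tinyN G X y ⊆ G.neighborFinset y \ P := by
          apply union_subset (sdiff_subset_sdiff hRN subset_rfl)
          intro v hv
          have hv' := mem_tinyN.1 hv
          rw [mem_sdiff, SimpleGraph.mem_neighborFinset]
          refine ⟨hv'.2.1, ?_⟩
          intro hvP
          have := hP3 v hvP
          have := hx0'.2.2
          have := hv'.2.2
          norm_num at *
          omega
        have h3 : Disjoint (R \ P) (tinyN G X y) := by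
          rw [disjoint_left]
          intro v hv hv2
          have h4 := hRH v (mem_sdiff.1 hv).1
          have := (mem_tinyN.1 hv2).2.2
          norm_num at *
          omega
        have h4 := card_le_card h2
        rw [card_union_of_disjoint h3] at h4
        omega
      have hs : ∑ v ∈ R \ P, 1 / (G.degree v : ℝ) ≤ (R \ P).card • (100 / (67 * (D : ℝ))) :=
        sum_le_card_nsmul _ _ _ (fun v hv => hinvH v (hRH v (mem_sdiff.1 hv).1))
      rw [nsmul_eq_mul] at hs
      have hMz : (M.card : ℝ) * (1 / 250 * (1 / ((lowN G X D y).card : ℝ))) = 0 := by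
        rw [hM0]; simp
      have hc' : 3 * (((R \ P).card : ℕ) : ℝ) ≤ 2 * ((k : ℝ) - 1) := by
        have : 3 * (R \ P).card + 2 ≤ 2 * k := by omega
        have : 3 * ((R \ P).card : ℝ) + 2 ≤ 2 * k := by exact_mod_cast this
        linarith
      have hk3 : (3 : ℝ) ≤ k := by exact_mod_cast hmin x0
      have hs2 : ((R \ P).card : ℝ) * (100 / (67 * (D : ℝ))) ≤ (2 / 3 * ((k : ℝ) - 1)) * (100 / (67 * (D : ℝ))) := by
        apply mul_le_mul_of_nonneg_right (by linarith) (by positivity)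
      have hfin : ((D : ℝ) + 1 - k) / D + 4 * ((k : ℝ) - 2) / (D : ℝ) ^ 2 +
          (2 / 3 * ((k : ℝ) - 1)) * (100 / (67 * (D : ℝ))) < 1 := by
        have : 1 - (((D : ℝ) + 1 - k) / D + 4 * ((k : ℝ) - 2) / (D : ℝ) ^ 2 +
          (2 / 3 * ((k : ℝ) - 1)) * (100 / (67 * (D : ℝ)))) =
          ((k - 1) * (D / 201) - 4 * (k - 2)) / (D : ℝ) ^ 2 := by
          field_simp
          ring
        have h5 : 0 < ((k - 1) * (D / 201) - 4 * (k - 2)) / (D : ℝ) ^ 2 := by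
          apply div_pos _ (by positivity)
          nlinarith
        linarith
      rw [hMz]
      linarith
    · have hw2 : w = 39 / 100 := by rw [hw, if_neg hF]
      obtain ⟨x0, hx0⟩ := hT
      have hx0' := mem_tinyN.1 hx0
      obtain ⟨φ, h⟩ := hcol x0 y hx0'.2.1.symm
      obtain ⟨P, hP1, hP2, hP3, hP4⟩ := rsum h hno hdeg hD hRlow
      have hc : (R \ P).card ≤ G.degree x0 := by
        have h1 := hNP P hP1 _ hP2
        have h2 := card_le_card (sdiff_subset_sdiff hRN (subset_refl P))
        omega
      have hs : ∑ v ∈ R \ P, 1 / (G.degree v : ℝ) ≤ (R \ P).card • (4 / (D : ℝ)) :=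
        sum_le_card_nsmul _ _ _ (fun v hv => hinv v (mem_sdiff.1 hv).1)
      rw [nsmul_eq_mul] at hs
      have hc' : ((R \ P).card : ℝ) ≤ 10000000000000 := by
        have := hx0'.2.2
        have : (R \ P).card ≤ 10000000000000 := by norm_num at this; omega
        exact_mod_cast this
      have hk : (G.degree x0 : ℝ) ≤ 10000000000000 := by
        have : G.degree x0 ≤ 10000000000000 := by
          have := hx0'.2.2
          norm_num at this; omega
        exact_mod_cast this
      have hk3 : (3 : ℝ) ≤ G.degree x0 := by exact_mod_cast hmin x0
      have hs2 : ((R \ P).card : ℝ) * (4 / D) ≤ 1 / 1000 := by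
        rw [← mul_div_assoc, div_le_iff₀ hD0]
        linarith
      have hs3 : ((D : ℝ) + 1 - G.degree x0) / D ≤ 1 := by
        rw [div_le_one hD0]; linarith
      have hs4 : 4 * ((G.degree x0 : ℝ) - 2) / (D : ℝ) ^ 2 ≤ 1 / 1000 := by
        rw [div_le_iff₀ (by positivity)]
        nlinarith
      linarith
  have hT0 : (tinyN G X y).card = 0 := by
    rw [not_nonempty_iff_eq_empty] at hT
    rw [hT, card_empty]
  rw [hT0]
  simp only [Nat.cast_zero, zero_mul, zero_add]
  set RL := R.filter (fun v => 100 * G.degree v ≤ 67 * D) with hRL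
  by_cases hB : RL.Nonempty
  · obtain ⟨x0, hx0, hmin0⟩ := exists_min_image RL (fun v => G.degree v) hB
    obtain ⟨hx0R, hx0l⟩ := mem_filter.1 hx0
    obtain ⟨hx0U, hx0c⟩ := mem_filter.1 hx0R
    have hx0X := ((hU x0).1 hx0U)
    obtain ⟨φ, h⟩ := hcol x0 y hx0X.2.symm
    obtain ⟨P, hP1, hP2, hP3, hP4⟩ := rsum h hno hdeg hD hRlow
    have hx0c' := hx0c.resolve_left (by omega)
    obtain ⟨hk1, hk2⟩ := unsat_claim hcol hno hdeg hD hX hx0X.1 hx0c'.1 hx0l hx0c'.2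
    have hk3 := hk2 y hx0X.2.symm
    set k := G.degree x0 with hkdef
    set l := (R \ P).filter (fun v => 100 * G.degree v ≤ 67 * D) with hl
    set u := (R \ P).filter (fun v => ¬ 100 * G.degree v ≤ 67 * D) with hu
    have hlu : l.card + u.card = (R \ P).card := card_filter_add_card_filter_not _
    have hsplit : ∑ v ∈ l, 1 / (G.degree v : ℝ) + ∑ v ∈ u, 1 / (G.degree v : ℝ) =
        ∑ v ∈ R \ P, 1 / (G.degree v : ℝ) := sum_filter_add_sum_filter_not _ _ _
    have hc : (R \ P).card + 1 ≤ k := by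
      have h1 := hNP P hP1 _ hP2
      have h2 := card_le_card (sdiff_subset_sdiff hRN (subset_refl P))
      omega
    have hlB : l.card ≤ (lowN G X D y).card := by
      apply card_le_card
      intro v hv
      obtain ⟨h1, h2⟩ := mem_filter.1 hv
      have h3 := (hU v).1 (mem_filter.1 (mem_sdiff.1 h1).1).1
      exact mem_lowN.2 ⟨h3.1, h3.2, h2⟩
    have hk1' : (325 : ℝ) * D < 1000 * k := by exact_mod_cast hk1
    have hx0l' : (100 : ℝ) * k ≤ 67 * D := by exact_mod_cast hx0l
    have hk0 : (0 : ℝ) < k := by linarith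
    have s1 : ∑ v ∈ l, 1 / (G.degree v : ℝ) ≤ l.card • (1 / (k : ℝ)) := by
      apply sum_le_card_nsmul
      intro v hv
      obtain ⟨h1, h2⟩ := mem_filter.1 hv
      have h3 : v ∈ RL := mem_filter.2 ⟨(mem_sdiff.1 h1).1, h2⟩
      apply one_div_le_one_div_of_le hk0
      exact_mod_cast hmin0 v h3
    have s2 : ∑ v ∈ u, 1 / (G.degree v : ℝ) ≤ u.card • (100 / (67 * (D : ℝ))) := by
      apply sum_le_card_nsmul
      intro v hv
      exact hinvH v (not_le.1 (mem_filter.1 hv).2)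
    rw [nsmul_eq_mul] at s1 s2
    have hc' : (u.card : ℝ) ≤ k - l.card := by
      have : u.card + l.card ≤ k := by omega
      have : (u.card : ℝ) + l.card ≤ k := by exact_mod_cast this
      linarith
    have s3 : (u.card : ℝ) * (100 / (67 * (D : ℝ))) ≤ (k - l.card) * (100 / (67 * (D : ℝ))) :=
      mul_le_mul_of_nonneg_right hc' (by positivity)
    have hBr : (l.card : ℝ) * 3250 * D + 3249 * D * k < (10000 * k + 20000) * k + 3 * 3250 * D := by
      have a1 : ((lowN G X D y).card : ℝ) * 3250 * D + 3249 * D * k <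
        (10000 * k + 20000) * k + 3 * 3250 * D := by exact_mod_cast hk3
      have a2 : (l.card : ℝ) ≤ (lowN G X D y).card := by exact_mod_cast hlB
      nlinarith
    have hnum := numB hD' hk1' hx0l' hBr
    linarith
  · have hRH : ∀ v ∈ R, 67 * D < 100 * G.degree v := by
      intro v hv
      by_contra hn
      exact hB ⟨v, mem_filter.2 ⟨hv, by omega⟩⟩
    by_cases hR0 : R.Nonempty
    · obtain ⟨x0, hx0, hmin0⟩ := exists_min_image R (fun v => G.degree v) hR0
      have hx0X := ((hU x0).1 (mem_filter.1 hx0).1)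
      obtain ⟨φ, h⟩ := hcol x0 y hx0X.2.symm
      obtain ⟨P, hP1, hP2, hP3, hP4⟩ := rsum h hno hdeg hD hRlow
      have hk : (67 : ℝ) * D < 100 * G.degree x0 := by exact_mod_cast hRH x0 hx0
      have hkD : (G.degree x0 : ℝ) ≤ D := by exact_mod_cast hdeg x0
      have hk0 : (0 : ℝ) < G.degree x0 := by linarith
      have hc : (R \ P).card ≤ G.degree x0 := by
        have h1 := hNP P hP1 _ hP2
        have h2 := card_le_card (sdiff_subset_sdiff hRN (subset_refl P))
        omega
      have hc' : ((R \ P).card : ℝ) ≤ G.degree x0 := by exact_mod_cast hc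
      have s1 : ∑ v ∈ R \ P, 1 / (G.degree v : ℝ) ≤ (R \ P).card • (1 / (G.degree x0 : ℝ)) := by
        apply sum_le_card_nsmul
        intro v hv
        apply one_div_le_one_div_of_le hk0
        exact_mod_cast hmin0 v (mem_sdiff.1 hv).1
      have s2 : (R \ P).card • (1 / (G.degree x0 : ℝ)) ≤ 1 := by
        rw [nsmul_eq_mul, mul_one_div, div_le_one hk0]
        exact hc'
      have s3 : ((D : ℝ) + 1 - G.degree x0) / D ≤ 34 / 100 := by
        rw [div_le_iff₀ hD0]; linarith
      have s4 : 4 * ((G.degree x0 : ℝ) - 2) / (D : ℝ) ^ 2 ≤ 1 / 1000 := by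
        rw [div_le_iff₀ (by positivity)]
        nlinarith
      linarith
    · rw [not_nonempty_iff_eq_empty] at hR0
      rw [hR0, sum_empty]
      linarith

end

section
variable [Fintype V] [DecidableRel G.Adj]

lemma exists_col (hD : D ≠ 0) (hxy : G.Adj x y) (h : chromIndex (G.deleteEdges {s(x, y)}) = D) :
    ∃ φ, Col G D x y φ := by
  classical
  set G' := G.deleteEdges {s(x, y)} with hG'
  have hadj : ∀ u v, G'.Adj u v ↔ G.Adj u v ∧ ¬ ((u = x ∧ v = y) ∨ (u = y ∧ v = x)) := by
    intro u v
    rw [hG', SimpleGraph.deleteEdges_adj]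
    simp [Sym2.eq_iff]
  have hne : {k | ∃ φ : V → V → ℕ, IsEdgeColoring G' k φ}.Nonempty := by
    by_contra hn
    rw [Set.not_nonempty_iff_eq_empty] at hn
    unfold chromIndex at h
    rw [hn, Nat.sInf_empty] at h
    exact hD h.symm
  have hmem := Nat.sInf_mem hne
  change chromIndex G' ∈ _ at hmem
  rw [h] at hmem
  obtain ⟨ψ, h1, h2, h3⟩ := hmem
  have hpos : ∀ u v, G'.Adj u v → 1 ≤ ψ u v ∧ ψ u v ≤ D := fun u v huv => mem_Icc.1 (h2 huv)
  refine ⟨fun u v => if G'.Adj u v then ψ u v else 0, ?_, ?_, ?_, ?_, ?_, ?_, hxy⟩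
  · intro u v
    simp only [G'.adj_comm u v, h1 u v]
  · intro u v
    split_ifs with hh
    · exact (hpos u v hh).2
    · exact Nat.zero_le _
  · intro u v hh
    split_ifs at hh with h4
    · exact ((hadj u v).1 h4).1
    · exact absurd rfl hh
  · intro u v w h0 he
    split_ifs at h0 he with h4 h5
    · by_contra hvw
      exact h3 h4 h5 hvw he
    · exact absurd he h0
    · exact absurd rfl h0
    · exact absurd rfl h0
  · skip
    rw [if_neg]
    rw [hadj]
    tauto
  · intro u v huv h0
    split_ifs at h0 with h4
    · have := (hpos u v h4).1
      omega
    · rw [hadj] at h4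
      tauto

lemma no_col (h : chromIndex G = D + 1) : NoCol G D := by
  intro φ h1 h2 h3 h4
  have : chromIndex G ≤ D := by
    apply Nat.sInf_le
    refine ⟨φ, h1, ?_, ?_⟩
    · intro u v huv
      exact mem_Icc.2 ⟨Nat.pos_of_ne_zero (h3 u v huv), h2 u v⟩
    · intro v a b ha hb hab he
      exact hab (h4 v a b (h3 v a ha) he)
  omega

lemma final (hG : IsDeltaCritical G) (hmin : ∀ v, 3 ≤ G.degree v) (hmax : 5 ^ 25 ≤ G.maxDegree)
    {X : Finset V} (hX : ∀ u ∈ X, ∀ v ∈ X, u ≠ v → ¬ G.Adj u v) :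
    (X.card : ℝ) < 7 * (Fintype.card V : ℝ) / 12 := by
  classical
  obtain ⟨hconn, hchi, hcrit⟩ := hG
  have hno : NoCol G G.maxDegree := no_col hchi
  have hcol : ∀ x y, G.Adj x y → ∃ φ, Col G G.maxDegree x y φ := by
    intro x y hxy
    apply exists_col _ hxy (hcrit _ hxy)
    have : 0 < G.maxDegree := lt_of_lt_of_le (by norm_num) hmax
    omega
  have hdeg : ∀ v, G.degree v ≤ G.maxDegree := fun v => G.degree_le_maxDegree v
  have h1 : (X.card : ℝ) ≤ ∑ x ∈ X, ∑ y ∈ G.neighborFinset x, om G X G.maxDegree y x := by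
    have := card_nsmul_le_sum X (fun x => ∑ y ∈ G.neighborFinset x, om G X G.maxDegree y x) 1
      (fun x hx => receive hcol hno hdeg hmin hmax hX hx)
    simpa using this
  have h2 : ∑ x ∈ X, ∑ y ∈ G.neighborFinset x, om G X G.maxDegree y x =
      ∑ y ∈ Xᶜ, ∑ x ∈ X.filter (fun x => G.Adj y x), om G X G.maxDegree y x := by
    apply sum_comm'
    intro x y
    rw [SimpleGraph.mem_neighborFinset, mem_filter, mem_compl]
    constructor
    · rintro ⟨hx, hxy⟩
      exact ⟨⟨hx, hxy.symm⟩, fun hy => hX x hx y hy hxy.ne hxy⟩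
    · rintro ⟨⟨hx, hxy⟩, _⟩
      exact ⟨hx, hxy.symm⟩
  have hne : Xᶜ.Nonempty := by
    obtain ⟨v⟩ := hconn.nonempty
    by_contra hn
    rw [not_nonempty_iff_eq_empty, compl_eq_empty_iff] at hn
    have h3 : 0 < (G.neighborFinset v).card := by
      rw [G.card_neighborFinset_eq_degree]
      have := hmin v
      omega
    obtain ⟨u, hu⟩ := card_pos.1 h3
    rw [SimpleGraph.mem_neighborFinset] at hu
    exact hX v (by rw [hn]; exact mem_univ _) u (by rw [hn]; exact mem_univ _) hu.ne hu
  have h3 : ∑ y ∈ Xᶜ, ∑ x ∈ X.filter (fun x => G.Adj y x), om G X G.maxDegree y x <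
      ∑ y ∈ Xᶜ, (7 / 5 : ℝ) := by
    apply sum_lt_sum_of_nonempty hne
    intro y _
    exact give hcol hno hdeg hmin hmax hX (fun x => mem_filter)
  rw [sum_const, nsmul_eq_mul] at h3
  have h4 : (X.card : ℝ) + (Xᶜ.card : ℝ) = Fintype.card V := by
    exact_mod_cast card_add_card_compl X
  linarith

end

end Crit

/-- Let `G` be an `n`-vertex `Δ`-critical simple graph with minimum degree at least `3` and
maximum degree `Δ ≥ 5^25`. Then `α(G) < 7n/12`. -/
theorem statement1 {V : Type*} [Fintype V] (G : SimpleGraph V) [DecidableRel G.Adj]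
    (hG : IsDeltaCritical G) (hmin : ∀ v : V, 3 ≤ G.degree v)
    (hmax : 5 ^ 25 ≤ G.maxDegree) :
    (indepNum G : ℝ) < 7 * (Fintype.card V : ℝ) / 12 := by
  have h1 : {n | ∃ s : Finset V, (∀ u ∈ s, ∀ v ∈ s, u ≠ v → ¬ G.Adj u v) ∧
      s.card = n}.Nonempty := ⟨0, ∅, by simp, by simp⟩
  have h2 : BddAbove {n | ∃ s : Finset V, (∀ u ∈ s, ∀ v ∈ s, u ≠ v → ¬ G.Adj u v) ∧
      s.card = n} := ⟨Fintype.card V, by rintro _ ⟨s, -, rfl⟩; exact Finset.card_le_univ s⟩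
  obtain ⟨X, hX, hc⟩ := Nat.sSup_mem h1 h2
  have h3 := Crit.final hG hmin hmax hX
  rw [hc] at h3
  exact h3
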